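/- arXiv:2508.21509 — 6 statements merged into one kernel-verified Lean document; each statement's English description precedes it below -/
import Mathlib

section
/- Let B be a real n×n matrix with zero diagonal such that, for all i, j, B i j ≠ 0 if and only if B j i ≠ 0, and suppose the simple graph on {0,…,n−1} with i adjacent to j iff i ≠ j and B i j ≠ 0 is a tree (connected and acyclic). Then for every λ ∈ ℂ, the algebraic multiplicity of λ as an eigenvalue of B equals the algebraic multiplicity of −λ as an eigenvalue of B, where algebraic multiplicity means the multiplicity of the root in the characteristic polynomial of B viewed over ℂ. -/
open Polynomial Matrix

/-- If `s` is a sign vector such that the similarity by `diagonal s` negates `B`, then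
substituting `-X` changes the characteristic polynomial of `B` only by a sign. -/
theorem Matrix.charpoly_comp_neg_X_of_sign {n R : Type*} [Fintype n] [DecidableEq n]
    [CommRing R] (B : Matrix n n R) (s : n → R) (hs : ∀ i, s i * s i = 1)
    (hB : ∀ i j, s i * B i j * s j = -B i j) :
    B.charpoly.comp (-X) = (-1) ^ Fintype.card n * B.charpoly := by
  have hM : (charmatrix B).map (compRingHom (-X)) =
      -(diagonal (fun i => C (s i)) * charmatrix B * diagonal (fun i => C (s i))) := by
    ext1 i j
    rw [map_apply, neg_apply, mul_diagonal, diagonal_mul]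
    rcases eq_or_ne i j with rfl | hij
    · have h1 : C (s i) * C (s i) = (1 : R[X]) := by rw [← C_mul, hs, C_1]
      have h2 : C (s i) * C (B i i) * C (s i) = -C (B i i) := by
        rw [← C_mul, ← C_mul, hB, C_neg]
      simp only [charmatrix_apply_eq, coe_compRingHom_apply, sub_comp, X_comp, C_comp]
      linear_combination X * h1 - h2
    · have h2 : C (s i) * C (B i j) * C (s j) = -C (B i j) := by
        rw [← C_mul, ← C_mul, hB, C_neg]
      simp only [charmatrix_apply_ne _ _ _ hij, coe_compRingHom_apply, neg_comp, C_comp]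
      linear_combination -h2
  have hd : (∏ i, C (s i)) * ∏ i, C (s i) = (1 : R[X]) := by
    rw [← Finset.prod_mul_distrib]
    exact Finset.prod_eq_one fun i _ => by rw [← C_mul, hs, C_1]
  have h := congrArg det hM
  rw [← RingHom.mapMatrix_apply, ← RingHom.map_det, det_neg, det_mul, det_mul,
    det_diagonal, coe_compRingHom_apply] at h
  rw [charpoly, h]
  linear_combination (-1) ^ Fintype.card n * (charmatrix B).det * hd

/-- For a real matrix `B` with zero diagonal, combinatorially symmetric zero pattern, whose
underlying graph is a tree, the algebraic multiplicity of any eigenvalue `z` equals the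
algebraic multiplicity of `-z`. -/
theorem tree_matrix_eigen_symmetric (n : ℕ) (B : Matrix (Fin n) (Fin n) ℝ)
    (hdiag : ∀ i, B i i = 0)
    (hsym : ∀ i j, B i j ≠ 0 ↔ B j i ≠ 0)
    (htree : (SimpleGraph.fromRel (fun i j : Fin n => B i j ≠ 0)).IsTree)
    (z : ℂ) :
    (B.charpoly.map (algebraMap ℝ ℂ)).rootMultiplicity z
      = (B.charpoly.map (algebraMap ℝ ℂ)).rootMultiplicity (-z) := by
  obtain ⟨c⟩ := htree.colorable_two
  have hcomp := charpoly_comp_neg_X_of_sign B (fun i => if c i = 0 then 1 else -1)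
    (fun i => by split_ifs <;> norm_num) (fun i j => by
      by_cases h : B i j = 0
      · simp [h]
      have hij : i ≠ j := by
        rintro rfl
        exact h (hdiag i)
      have hc : c i ≠ c j := c.valid ((SimpleGraph.fromRel_adj _ _ _).2 ⟨hij, Or.inl h⟩)
      split_ifs with hi hj hj
      · exact absurd (hi.trans hj.symm) hc
      · ring
      · ring
      · omega)
  have hmap := congrArg (Polynomial.map (algebraMap ℝ ℂ)) hcomp
  simp only [Polynomial.map_comp, Polynomial.map_neg, map_X, Polynomial.map_mul,
    Polynomial.map_pow, Polynomial.map_one] at hmap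
  have hroot := rootMultiplicity_comp_C_mul_X_add_C (B.charpoly.map (algebraMap ℝ ℂ))
    (-1) 0 z isUnit_one.neg
  simp only [C_neg, C_1, C_0, add_zero, neg_mul, one_mul, hmap] at hroot
  rw [← hroot]
  rcases neg_one_pow_eq_or ℂ[X] (Fintype.card (Fin n)) with h | h <;> rw [h]
  · rw [one_mul]
  · rw [neg_one_mul, rootMultiplicity_eq_multiplicity, rootMultiplicity_eq_multiplicity]
    simp [multiplicity_neg]
end

section
/- Let P be a combinatorially symmetric tree sign pattern with 0-diagonal of order n. Suppose P does not allow repeated eigenvalues with zero real part: for every B ∈ Q(P) and every λ ∈ ℂ with Re λ = 0, the multiplicity of λ as a root of the characteristic polynomial of B over ℂ is at most 1. Then P requires a unique inertia. -/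
open Polynomial Matrix

/-- The qualitative class of a sign pattern. -/
def QClass {n : ℕ} (P : Matrix (Fin n) (Fin n) SignType) (B : Matrix (Fin n) (Fin n) ℝ) : Prop :=
  ∀ i j, SignType.sign (B i j) = P i j

noncomputable def charRoots {n : ℕ} (B : Matrix (Fin n) (Fin n) ℝ) : Multiset ℂ :=
  ((B.charpoly).map (algebraMap ℝ ℂ)).roots

/-- The inertia `(i₊, i₋, i₀)` of a real square matrix: the numbers of roots of its
characteristic polynomial over `ℂ` with positive, negative and zero real part. -/
noncomputable def inertia {n : ℕ} (B : Matrix (Fin n) (Fin n) ℝ) : ℕ × ℕ × ℕ :=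
  (((charRoots B).filter (fun z => 0 < z.re)).card,
   ((charRoots B).filter (fun z => z.re < 0)).card,
   ((charRoots B).filter (fun z => z.re = 0)).card)

def RequiresUniqueInertia {n : ℕ} (P : Matrix (Fin n) (Fin n) SignType) : Prop :=
  ∀ B₁ B₂, QClass P B₁ → QClass P B₂ → inertia B₁ = inertia B₂

open Filter Topology in
/-- A continuously differentiable family of real functions has, near a simple zero of one of its
members, exactly one zero of each nearby member. -/
lemma eventually_existsUnique_zero {F F' : ℝ → ℝ → ℝ}
    (hF : Continuous fun p : ℝ × ℝ => F p.1 p.2) (hF' : Continuous fun p : ℝ × ℝ => F' p.1 p.2)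
    (hd : ∀ t y, HasDerivAt (F t) (F' t y) y) {t₀ a : ℝ} (h₀ : F t₀ a = 0) (h₁ : F' t₀ a ≠ 0) :
    ∀ᶠ ε in 𝓝[>] (0 : ℝ), ∀ᶠ t in 𝓝 t₀, ∃! y, |y - a| < ε ∧ F t y = 0 := by
  wlog hpos : 0 < F' t₀ a generalizing F F'
  · have key := this (F := fun t y => -F t y) (F' := fun t y => -F' t y) hF.neg hF'.neg
      (fun t y => (hd t y).neg) (by simpa using h₀) (by simpa using h₁)
      (by simpa using lt_of_le_of_ne (not_lt.mp hpos) h₁)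
    simpa using key
  have hev : ∀ᶠ p in 𝓝 (t₀, a), 0 < F' p.1 p.2 := hF'.continuousAt.eventually (lt_mem_nhds hpos)
  obtain ⟨δ, hδ, hball⟩ := Metric.eventually_nhds_iff.mp hev
  filter_upwards [Ioo_mem_nhdsGT hδ] with ε hε
  have hmono : ∀ t, |t - t₀| < δ → StrictMonoOn (F t) (Set.Icc (a - ε) (a + ε)) := by
    intro t ht
    refine strictMonoOn_of_deriv_pos (convex_Icc _ _)
      (fun y _ => (hd t y).continuousAt.continuousWithinAt) fun y hy => ?_
    rw [interior_Icc] at hy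
    rw [(hd t y).deriv]
    refine @hball (t, y) ?_
    rw [Prod.dist_eq]
    refine max_lt (by simpa [Real.dist_eq] using ht) ?_
    rw [Real.dist_eq]
    exact (abs_lt.mpr ⟨by linarith [hy.1], by linarith [hy.2]⟩).trans hε.2
  have hm₀ := hmono t₀ (by simpa using hδ)
  have hl : F t₀ (a - ε) < 0 := h₀ ▸ hm₀ ⟨le_rfl, by linarith [hε.1]⟩
    ⟨by linarith [hε.1], by linarith [hε.1]⟩ (by linarith [hε.1])
  have hr : 0 < F t₀ (a + ε) := h₀ ▸ hm₀ ⟨by linarith [hε.1], by linarith [hε.1]⟩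
    ⟨by linarith [hε.1], le_rfl⟩ (by linarith [hε.1])
  have hcont : ∀ y, Continuous fun t => F t y := fun y =>
    hF.comp (continuous_id.prodMk continuous_const)
  filter_upwards [(hcont _).continuousAt.eventually (gt_mem_nhds hl),
    (hcont _).continuousAt.eventually (lt_mem_nhds hr), Metric.ball_mem_nhds t₀ hδ]
    with t htl htr ht
  obtain ⟨y, hy, hy₀⟩ := intermediate_value_Ioo (by linarith [hε.1] : a - ε ≤ a + ε)
    (fun y _ => (hd t y).continuousAt.continuousWithinAt) (Set.mem_Ioo.mpr ⟨htl, htr⟩)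
  refine ⟨y, ⟨abs_lt.mpr ⟨by linarith [hy.1], by linarith [hy.2]⟩, hy₀⟩, ?_⟩
  rintro z ⟨hz, hz₀⟩
  rw [abs_lt] at hz
  exact (hmono t ht).injOn ⟨by linarith [hz.1], by linarith [hz.2]⟩ ⟨hy.1.le, hy.2.le⟩
    (hz₀.trans hy₀.symm)

open Filter Topology in
/-- In a continuously differentiable family of real functions whose zeros stay in a fixed compact
set, the number of zeros is locally constant at a member with finitely many zeros, all simple. -/
lemma eventually_ncard_zeros_eq {F F' : ℝ → ℝ → ℝ}
    (hF : Continuous fun p : ℝ × ℝ => F p.1 p.2) (hF' : Continuous fun p : ℝ × ℝ => F' p.1 p.2)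
    (hd : ∀ t y, HasDerivAt (F t) (F' t y) y) {S K : Set ℝ} (hK : IsCompact K)
    (hb : ∀ t ∈ S, ∀ y, F t y = 0 → y ∈ K) {t₀ : ℝ} (hfin : {y | F t₀ y = 0}.Finite)
    (hsimple : ∀ y, F t₀ y = 0 → F' t₀ y ≠ 0) :
    ∀ᶠ t in 𝓝[S] t₀, {y | F t y = 0}.ncard = {y | F t₀ y = 0}.ncard := by
  have h₁ : ∀ᶠ ε in 𝓝[>] (0 : ℝ), ∀ a ∈ {y | F t₀ y = 0},
      ∀ᶠ t in 𝓝 t₀, ∃! y, |y - a| < ε ∧ F t y = 0 :=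
    (eventually_all_finite hfin).mpr fun a ha =>
      eventually_existsUnique_zero hF hF' hd ha (hsimple a ha)
  have h₂ : ∀ᶠ ε in 𝓝[>] (0 : ℝ), ∀ a ∈ {y | F t₀ y = 0}, ∀ b ∈ {y | F t₀ y = 0},
      a ≠ b → 2 * ε < |a - b| := by
    refine (eventually_all_finite hfin).mpr fun a _ => (eventually_all_finite hfin).mpr fun b _ => ?_
    by_cases hab : a = b
    · simp [hab]
    · have : 0 < |a - b| / 2 := half_pos (abs_pos.mpr (sub_ne_zero.mpr hab))
      filter_upwards [Ioo_mem_nhdsGT this] with ε hε _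
      linarith [hε.2]
  obtain ⟨ε, hε₁, hε₂, hε₀⟩ := (h₁.and (h₂.and self_mem_nhdsWithin)).exists
  have hU : IsOpen (⋃ a ∈ {y | F t₀ y = 0}, Metric.ball a ε) :=
    isOpen_biUnion fun a _ => Metric.isOpen_ball
  have hout : ∀ᶠ t in 𝓝 t₀, ∀ y ∈ K \ ⋃ a ∈ {y | F t₀ y = 0}, Metric.ball a ε, F t y ≠ 0 := by
    refine (hK.diff hU).eventually_forall_of_forall_eventually fun y hy => ?_
    refine hF.continuousAt.eventually (isOpen_ne.mem_nhds fun h => hy.2 ?_)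
    exact Set.mem_biUnion (x := y) h (Metric.mem_ball_self hε₀)
  filter_upwards [hout.filter_mono nhdsWithin_le_nhds,
    ((eventually_all_finite hfin).mpr hε₁).filter_mono nhdsWithin_le_nhds, self_mem_nhdsWithin]
    with t ht hex htS
  choose! g hg using fun a ha => (hex a ha).exists
  have himage : g '' {y | F t₀ y = 0} = {y | F t y = 0} := by
    ext y
    constructor
    · rintro ⟨a, ha, rfl⟩
      exact (hg a ha).2
    · intro hy
      have hyU : y ∈ ⋃ a ∈ {y | F t₀ y = 0}, Metric.ball a ε := by
        by_contra hyU
        exact ht y ⟨hb t htS y hy, hyU⟩ hy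
      obtain ⟨a, ha, hya⟩ := Set.mem_iUnion₂.mp hyU
      exact ⟨a, ha, (hex a ha).unique (hg a ha) ⟨by simpa [Real.dist_eq] using hya, hy⟩⟩
  rw [← himage]
  refine Set.InjOn.ncard_image fun a ha b hb hab => ?_
  by_contra hne
  have h₁ := (hg a ha).1
  have h₂ := (hg b hb).1
  rw [← hab] at h₂
  have h₃ := hε₂ a ha b hb hne
  have h₄ := abs_sub_le a (g a) b
  rw [abs_sub_comm a (g a)] at h₄
  linarith

lemma continuous_eval_map_evalRingHom (Q : ℝ[X][X]) :
    Continuous fun p : ℝ × ℝ => (Q.map (evalRingHom p.1)).eval p.2 := by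
  simp only [eval_map, eval₂_eq_sum_range, coe_evalRingHom]
  fun_prop

/-- The number of real roots is constant along a polynomial path of monic real polynomials with
uniformly bounded, simple real roots. -/
lemma ncard_realRoots_eq_of_simple {Q : ℝ[X][X]} (hQ : Q.Monic) {M : ℝ}
    (hM : ∀ t ∈ Set.Icc (0 : ℝ) 1, ∀ y, (Q.map (evalRingHom t)).eval y = 0 → |y| ≤ M)
    (hsimple : ∀ t ∈ Set.Icc (0 : ℝ) 1, ∀ y, (Q.map (evalRingHom t)).eval y = 0 →
      (Q.map (evalRingHom t)).derivative.eval y ≠ 0) :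
    {y | (Q.map (evalRingHom 0)).eval y = 0}.ncard =
      {y | (Q.map (evalRingHom 1)).eval y = 0}.ncard := by
  have hcont : ContinuousOn (fun t : ℝ => {y | (Q.map (evalRingHom t)).eval y = 0}.ncard)
      (Set.Icc 0 1) := by
    intro t ht
    refine tendsto_nhds_of_eventually_eq ?_
    refine eventually_ncard_zeros_eq (F := fun t y => (Q.map (evalRingHom t)).eval y)
      (F' := fun t y => (Q.map (evalRingHom t)).derivative.eval y)
      (continuous_eval_map_evalRingHom Q) ?_ (fun t y => Polynomial.hasDerivAt _ _)
      (isCompact_Icc (a := -M) (b := M)) (fun t ht y hy => abs_le.mp (hM t ht y hy)) ?_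
      (hsimple t ht)
    · simpa only [derivative_map] using continuous_eval_map_evalRingHom (derivative Q)
    · exact Polynomial.finite_setOfPred_isRoot (hQ.map _).ne_zero
  exact isPreconnected_Icc.constant hcont (by simp) (by simp)

/-- If `A` is diagonally similar to `w • B`, then their characteristic polynomials differ by the
corresponding rescaling of the variable. -/
lemma charpoly_comp_of_diagonal_similar {K : Type*} [Field K] [Infinite K] {n : ℕ}
    {A B : Matrix (Fin n) (Fin n) K} {d : Fin n → K} (hd : ∀ u, d u ≠ 0) {w : K}
    (h : ∀ u v, d u * A u v = w * B u v * d v) :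
    A.charpoly.comp (C w * X) = C (w ^ n) * B.charpoly := by
  refine Polynomial.funext fun z => ?_
  have hmul : diagonal d * (scalar (Fin n) (w * z) - A) =
      (w • (scalar (Fin n) z - B)) * diagonal d := by
    ext u v
    have huv := h u v
    by_cases hne : u = v
    · subst hne
      simp only [diagonal_mul, mul_diagonal, Matrix.sub_apply, Matrix.smul_apply, scalar_apply,
        diagonal_apply_eq, smul_eq_mul]
      linear_combination -huv
    · simp only [diagonal_mul, mul_diagonal, Matrix.sub_apply, Matrix.smul_apply, scalar_apply,
        diagonal_apply_ne _ hne, smul_eq_mul]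
      linear_combination -huv
  have hdet := congrArg Matrix.det hmul
  rw [det_mul, det_mul, det_smul, mul_comm, Fintype.card_fin] at hdet
  have hne : (diagonal d).det ≠ 0 := by
    rw [det_diagonal]
    exact Finset.prod_ne_zero_iff.mpr fun u _ => hd u
  simpa [eval_charpoly] using mul_right_cancel₀ hne hdet

/-- A real eigenvalue is bounded by the sum of the absolute values of the entries. -/
lemma abs_le_sum_of_eval_charpoly_eq_zero {n : ℕ} {A : Matrix (Fin n) (Fin n) ℝ} {y : ℝ}
    (hy : A.charpoly.eval y = 0) : |y| ≤ ∑ i, ∑ j, |A i j| := by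
  by_contra! hlt
  rw [eval_charpoly] at hy
  refine det_ne_zero_of_sum_row_lt_diag (fun k => ?_) hy
  have hrow : ∑ j, |A k j| ≤ ∑ i, ∑ j, |A i j| :=
    Finset.single_le_sum (f := fun i => ∑ j, |A i j|)
      (fun i _ => Finset.sum_nonneg fun j _ => abs_nonneg _) (Finset.mem_univ k)
  rw [← Finset.add_sum_erase _ _ (Finset.mem_univ k)] at hrow
  have hsum : ∑ j ∈ Finset.univ.erase k, ‖(scalar (Fin n) y - A) k j‖ =
      ∑ j ∈ Finset.univ.erase k, |A k j| := by
    refine Finset.sum_congr rfl fun j hj => ?_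
    simp [diagonal_apply_ne' _ (Finset.ne_of_mem_erase hj)]
  rw [hsum]
  have habs : |y| - |A k k| ≤ ‖(scalar (Fin n) y - A) k k‖ := by
    simpa using abs_sub_abs_le_abs_sub y (A k k)
  linarith

/-- A sign for the rows of a matrix whose graph is coloured with two colours. -/
def colorSign {n : ℕ} (c : Fin n → Fin 2) (u : Fin n) : ℝ := if c u = 0 then -1 else 1

/-- Multiplying the rows of a bipartite matrix by the signs of a `2`-colouring rotates its spectrum
by a right angle. -/
lemma charpoly_comp_I_mul_X {n : ℕ} {c : Fin n → Fin 2} {B : Matrix (Fin n) (Fin n) ℝ}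
    (hc : ∀ u v, B u v ≠ 0 → c u ≠ c v) :
    (B.charpoly.map (algebraMap ℝ ℂ)).comp (C Complex.I * X) = C (Complex.I ^ n) *
      ((of fun u v => colorSign c u * B u v).charpoly.map (algebraMap ℝ ℂ)) := by
  rw [← charpoly_map, ← charpoly_map]
  refine charpoly_comp_of_diagonal_similar (d := fun u => if c u = 0 then 1 else Complex.I)
    (fun u => by split_ifs <;> simp) fun u v => ?_
  by_cases hB : B u v = 0
  · simp [hB]
  have := hc u v hB
  rcases Fin.exists_fin_two.mp ⟨c u, rfl⟩ with hu | hu <;>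
    rcases Fin.exists_fin_two.mp ⟨c v, rfl⟩ with hv | hv <;>
    simp_all [colorSign]
  linear_combination (B u v : ℂ) * Complex.I_mul_I

lemma charpoly_comp_neg_X {n : ℕ} {c : Fin n → Fin 2} {B : Matrix (Fin n) (Fin n) ℝ}
    (hc : ∀ u v, B u v ≠ 0 → c u ≠ c v) :
    (B.charpoly.map (algebraMap ℝ ℂ)).comp (-X) =
      C ((-1) ^ n) * B.charpoly.map (algebraMap ℝ ℂ) := by
  have key := charpoly_comp_of_diagonal_similar (A := B) (B := B) (w := -1)
    (d := colorSign c) (fun u => by unfold colorSign; split_ifs <;> simp) fun u v => ?_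
  · simpa [Polynomial.map_comp] using congrArg (Polynomial.map (algebraMap ℝ ℂ)) key
  by_cases hB : B u v = 0
  · simp [hB]
  have := hc u v hB
  rcases Fin.exists_fin_two.mp ⟨c u, rfl⟩ with hu | hu <;>
    rcases Fin.exists_fin_two.mp ⟨c v, rfl⟩ with hv | hv <;>
    simp_all [colorSign]

lemma card_charRoots {n : ℕ} (B : Matrix (Fin n) (Fin n) ℝ) : (charRoots B).card = n := by
  rw [charRoots, splits_iff_card_roots.mp (IsAlgClosed.splits _), natDegree_map,
    charpoly_natDegree_eq_dim, Fintype.card_fin]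

/-- The spectrum of a bipartite matrix is symmetric about the imaginary axis. -/
lemma card_filter_re_pos_eq_neg {n : ℕ} {c : Fin n → Fin 2} {B : Matrix (Fin n) (Fin n) ℝ}
    (hc : ∀ u v, B u v ≠ 0 → c u ≠ c v) :
    ((charRoots B).filter fun z => 0 < z.re).card =
      ((charRoots B).filter fun z => z.re < 0).card := by
  have h := congrArg roots (charpoly_comp_neg_X hc)
  rw [roots_comp_neg_X, roots_C_mul _ (by simp)] at h
  change (charRoots B).map (fun x => -x) = charRoots B at h
  conv_lhs => rw [← h]
  simp [Multiset.filter_map]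

lemma inertia_eq_of_card_filter_re_zero {n : ℕ} {c : Fin n → Fin 2}
    {B₁ B₂ : Matrix (Fin n) (Fin n) ℝ} (h₁ : ∀ u v, B₁ u v ≠ 0 → c u ≠ c v)
    (h₂ : ∀ u v, B₂ u v ≠ 0 → c u ≠ c v)
    (h : ((charRoots B₁).filter fun z => z.re = 0).card =
      ((charRoots B₂).filter fun z => z.re = 0).card) : inertia B₁ = inertia B₂ := by
  have htotal : ∀ B : Matrix (Fin n) (Fin n) ℝ, ((charRoots B).filter fun z => 0 < z.re).card +
      ((charRoots B).filter fun z => z.re < 0).card +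
      ((charRoots B).filter fun z => z.re = 0).card = n := by
    intro B
    conv_rhs => rw [← card_charRoots B]
    induction charRoots B using Multiset.induction_on with
    | empty => simp
    | cons z s ih =>
      rcases lt_trichotomy z.re 0 with hz | hz | hz
      · simp [hz, hz.ne, hz.not_gt]; omega
      · simp [hz]; omega
      · simp [hz, hz.ne', hz.not_gt]; omega
  have e₁ := card_filter_re_pos_eq_neg h₁
  have e₂ := card_filter_re_pos_eq_neg h₂
  have t₁ := htotal B₁
  have t₂ := htotal B₂
  simp only [inertia, Prod.mk.injEq]
  omega

lemma eval_I_mul_eq_zero_iff {n : ℕ} {c : Fin n → Fin 2} {B : Matrix (Fin n) (Fin n) ℝ}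
    (hc : ∀ u v, B u v ≠ 0 → c u ≠ c v) (y : ℝ) :
    (B.charpoly.map (algebraMap ℝ ℂ)).eval (Complex.I * y) = 0 ↔
      (of fun u v => colorSign c u * B u v).charpoly.eval y = 0 := by
  have h := congrArg (Polynomial.eval (y : ℂ)) (charpoly_comp_I_mul_X hc)
  rw [eval_comp, eval_mul, eval_C, eval_X, eval_mul, eval_C] at h
  rw [h, mul_eq_zero_iff_left (pow_ne_zero _ Complex.I_ne_zero), ← Complex.coe_algebraMap,
    eval_map_algebraMap, aeval_algebraMap_apply]
  simp

/-- If every purely imaginary eigenvalue of a bipartite matrix is simple, then every real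
eigenvalue of the row-signed matrix is simple. -/
lemma derivative_eval_ne_zero {n : ℕ} {c : Fin n → Fin 2} {B : Matrix (Fin n) (Fin n) ℝ}
    (hc : ∀ u v, B u v ≠ 0 → c u ≠ c v)
    (hs : ∀ z : ℂ, z.re = 0 → (B.charpoly.map (algebraMap ℝ ℂ)).rootMultiplicity z ≤ 1) {y : ℝ}
    (hy : (of fun u v => colorSign c u * B u v).charpoly.eval y = 0) :
    (of fun u v => colorSign c u * B u v).charpoly.derivative.eval y ≠ 0 := by
  intro hy'
  have h := congrArg (Polynomial.eval (y : ℂ))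
    (congrArg Polynomial.derivative (charpoly_comp_I_mul_X hc))
  have hzero : (of fun u v => colorSign c u * B u v).charpoly.derivative.aeval (y : ℂ) = 0 := by
    rw [← Complex.coe_algebraMap, aeval_algebraMap_apply]
    simp [hy']
  have hne : B.charpoly.map (algebraMap ℝ ℂ) ≠ 0 := ((charpoly_monic B).map _).ne_zero
  have hlt : 1 < (B.charpoly.map (algebraMap ℝ ℂ)).rootMultiplicity (Complex.I * y) := by
    rw [one_lt_rootMultiplicity_iff_isRoot hne]
    refine ⟨(eval_I_mul_eq_zero_iff hc y).mpr hy, ?_⟩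
    rw [derivative_C_mul, eval_mul, derivative_map, eval_map_algebraMap, hzero, mul_zero] at h
    simpa [derivative_comp, derivative_map, eval_map_algebraMap] using h
  exact absurd (hs _ (by simp)) (not_le.mpr hlt)

/-- The number of purely imaginary eigenvalues of a bipartite matrix is the number of real
eigenvalues of the row-signed matrix. -/
lemma card_filter_re_zero_eq_ncard {n : ℕ} {c : Fin n → Fin 2} {B : Matrix (Fin n) (Fin n) ℝ}
    (hc : ∀ u v, B u v ≠ 0 → c u ≠ c v)
    (hs : ∀ z : ℂ, z.re = 0 → (B.charpoly.map (algebraMap ℝ ℂ)).rootMultiplicity z ≤ 1) :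
    ((charRoots B).filter fun z => z.re = 0).card =
      {y : ℝ | (of fun u v => colorSign c u * B u v).charpoly.eval y = 0}.ncard := by
  classical
  have hne : B.charpoly.map (algebraMap ℝ ℂ) ≠ 0 := ((charpoly_monic B).map _).ne_zero
  have hnodup : ((charRoots B).filter fun z => z.re = 0).Nodup := by
    refine Multiset.nodup_iff_count_le_one.mpr fun z => ?_
    by_cases hz : z.re = 0
    · rw [Multiset.count_filter_of_pos (p := fun z : ℂ => z.re = 0) hz, charRoots, count_roots]
      exact hs z hz
    · simp [Multiset.count_filter_of_neg (p := fun z : ℂ => z.re = 0) hz]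
  rw [← Multiset.toFinset_card_of_nodup hnodup, ← Set.ncard_coe_finset]
  have hinj : Function.Injective fun y : ℝ => Complex.I * (y : ℂ) := fun x y hxy => by
    simpa using hxy
  rw [← Set.ncard_image_of_injective _ hinj]
  congr 1
  ext z
  simp only [Finset.mem_coe, Multiset.mem_toFinset, Multiset.mem_filter, charRoots,
    mem_roots hne, IsRoot.def, Set.mem_image, Set.mem_ofPred_eq]
  constructor
  · rintro ⟨hz, hre⟩
    have hz' : Complex.I * (z.im : ℂ) = z := by
      apply Complex.ext <;> simp [hre]
    exact ⟨z.im, (eval_I_mul_eq_zero_iff hc _).mp (hz'.symm ▸ hz), hz'⟩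
  · rintro ⟨y, hy, rfl⟩
    exact ⟨(eval_I_mul_eq_zero_iff hc y).mpr hy, by simp⟩

/-- The qualitative class of a sign pattern is convex. -/
lemma QClass.segment {n : ℕ} {P : Matrix (Fin n) (Fin n) SignType}
    {B₁ B₂ : Matrix (Fin n) (Fin n) ℝ} (h₁ : QClass P B₁) (h₂ : QClass P B₂) {t : ℝ}
    (ht : t ∈ Set.Icc (0 : ℝ) 1) :
    QClass P (of fun u v => B₁ u v + t * (B₂ u v - B₁ u v)) := by
  intro i j
  obtain ⟨ht₀, ht₁⟩ := ht
  have e₁ := h₁ i j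
  have e₂ := h₂ i j
  rw [of_apply]
  rcases lt_trichotomy (B₁ i j) 0 with h | h | h
  · rw [sign_neg h] at e₁
    rw [← e₁, sign_eq_neg_one_iff] at e₂
    rw [← e₁, sign_eq_neg_one_iff]
    exact (convex_Iio (0 : ℝ)).add_smul_sub_mem h e₂ ⟨ht₀, ht₁⟩
  · rw [h, sign_zero] at e₁
    rw [← e₁, sign_eq_zero_iff] at e₂
    rw [← e₁, sign_eq_zero_iff]
    simp [h, e₂]
  · rw [sign_pos h] at e₁
    rw [← e₁, sign_eq_one_iff] at e₂
    rw [← e₁, sign_eq_one_iff]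
    exact (convex_Ioi (0 : ℝ)).add_smul_sub_mem h e₂ ⟨ht₀, ht₁⟩

/-- A combinatorially symmetric tree sign pattern with `0`-diagonal that does not allow
repeated eigenvalues with zero real part requires a unique inertia. -/
theorem tree_sign_pattern_requires_unique_inertia (n : ℕ)
    (P : Matrix (Fin n) (Fin n) SignType)
    (hdiag : ∀ i, P i i = 0)
    (hsym : ∀ i j, P i j ≠ 0 ↔ P j i ≠ 0)
    (htree : (SimpleGraph.fromRel (fun i j : Fin n => P i j ≠ 0)).IsTree)
    (hnorep : ∀ B, QClass P B → ∀ z : ℂ, z.re = 0 →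
      (B.charpoly.map (algebraMap ℝ ℂ)).rootMultiplicity z ≤ 1) :
    RequiresUniqueInertia P := by
  intro B₁ B₂ h₁ h₂
  obtain ⟨c⟩ := htree.isBipartite
  have hc : ∀ B, QClass P B → ∀ u v, B u v ≠ 0 → c u ≠ c v := by
    intro B hB u v huv
    have hP : P u v ≠ 0 := by rwa [← hB u v, Ne, sign_eq_zero_iff]
    refine c.valid ((SimpleGraph.fromRel_adj _ _ _).mpr ⟨?_, Or.inl hP⟩)
    rintro rfl
    exact hP (hdiag u)
  refine inertia_eq_of_card_filter_re_zero (hc _ h₁) (hc _ h₂) ?_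
  rw [card_filter_re_zero_eq_ncard (hc _ h₁) (hnorep _ h₁),
    card_filter_re_zero_eq_ncard (hc _ h₂) (hnorep _ h₂)]
  let N : Matrix (Fin n) (Fin n) ℝ[X] :=
    of fun u v => C (colorSign c u) * (C (B₁ u v) + X * C (B₂ u v - B₁ u v))
  have hN : ∀ t : ℝ, N.charpoly.map (evalRingHom t) = (of fun u v => colorSign c u *
      (of fun u v => B₁ u v + t * (B₂ u v - B₁ u v)) u v).charpoly := by
    intro t
    rw [← charpoly_map]
    congr 1
    ext u v
    simp [N]
  have key := ncard_realRoots_eq_of_simple (charpoly_monic N)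
    (M := ∑ i, ∑ j, (|B₁ i j| + |B₂ i j|)) ?_ ?_
  · rw [hN, hN] at key
    simpa using key
  · intro t ht y hy
    rw [hN] at hy
    refine (abs_le_sum_of_eval_charpoly_eq_zero hy).trans ?_
    refine Finset.sum_le_sum fun i _ => Finset.sum_le_sum fun j _ => ?_
    have hsign : |colorSign c i| = 1 := by unfold colorSign; split_ifs <;> simp
    rw [of_apply, of_apply, abs_mul, hsign, one_mul,
      show B₁ i j + t * (B₂ i j - B₁ i j) = (1 - t) * B₁ i j + t * B₂ i j by ring]
    refine (abs_add_le _ _).trans ?_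
    rw [abs_mul, abs_mul, abs_of_nonneg ht.1, abs_of_nonneg (sub_nonneg.mpr ht.2)]
    nlinarith [abs_nonneg (B₁ i j), abs_nonneg (B₂ i j), ht.1, ht.2]
  · intro t ht y hy
    rw [hN] at hy ⊢
    exact derivative_eval_ne_zero (hc _ (h₁.segment h₂ ht)) (hnorep _ (h₁.segment h₂ ht)) hy
end

section
/- Let P be an irreducible tridiagonal sign pattern with 0-diagonal of order n ≥ 2. If P allows repeated zero eigenvalues, i.e., there exists B ∈ Q(P) such that 0 is a root of the characteristic polynomial of B of multiplicity at least 2, then P does not require a unique inertia: there exist B₁, B₂ ∈ Q(P) with In(B₁) ≠ In(B₂). -/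
open Polynomial Matrix

/-- The sign of the constant coefficient of a real monic polynomial not vanishing at `0` is given
by the parity of the number of roots in the open right half plane. -/
theorem coeff_zero_mul_neg_one_pow_card_roots_pos {q : ℝ[X]} (hq : q.Monic)
    (h0 : q.coeff 0 ≠ 0) :
    0 < q.coeff 0 *
      (-1) ^ ((q.map (algebraMap ℝ ℂ)).roots.filter (fun z => 0 < z.re)).card := by
  induction hn : q.natDegree using Nat.strong_induction_on generalizing q with
  | _ n ih =>
    rcases Nat.eq_zero_or_pos n with rfl | hpos
    · rw [hq.natDegree_eq_zero.mp hn]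
      simp
    have hdeg : (q.map (algebraMap ℝ ℂ)).degree ≠ 0 := by
      rw [degree_map, degree_eq_natDegree hq.ne_zero, hn]
      exact_mod_cast hpos.ne'
    obtain ⟨z, hz⟩ := IsAlgClosed.exists_root _ hdeg
    have hz' : aeval z q = 0 := by rwa [IsRoot, eval_map_algebraMap] at hz
    by_cases him : z.im = 0
    · obtain ⟨a, rfl⟩ : ∃ a : ℝ, (a : ℂ) = z := ⟨z.re, Complex.ext rfl (by simp [him])⟩
      have ha : q.IsRoot a := by
        have h : aeval (algebraMap ℝ ℂ a) q = 0 := hz'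
        rw [aeval_algebraMap_apply] at h
        simpa using h
      obtain ⟨r, rfl⟩ := dvd_iff_isRoot.mpr ha
      have hr : r.Monic := (monic_X_sub_C a).of_mul_monic_left hq
      have hdegr : r.natDegree < n := by
        rw [← hn, (monic_X_sub_C a).natDegree_mul hr, natDegree_X_sub_C]
        omega
      rw [mul_coeff_zero] at h0 ⊢
      have key := ih _ hdegr hr (right_ne_zero_of_mul h0) rfl
      have ha0 : a ≠ 0 := by
        rintro rfl
        simp at h0
      have hne : (X - C (a : ℂ)) * r.map (algebraMap ℝ ℂ) ≠ 0 :=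
        mul_ne_zero (X_sub_C_ne_zero _) ((hr.map _).ne_zero)
      have hmap : ((X - C a) * r).map (algebraMap ℝ ℂ) =
          (X - C (a : ℂ)) * r.map (algebraMap ℝ ℂ) := by simp
      rw [hmap, roots_mul hne, roots_X_sub_C, Multiset.filter_add, Multiset.filter_singleton,
        Multiset.card_add, pow_add]
      rcases lt_or_gt_of_ne ha0 with h | h
      · simp only [Complex.ofReal_re, h.not_gt, if_false]
        simp only [coeff_sub, coeff_X_zero, coeff_C_zero, zero_sub, Multiset.empty_eq_zero,
          Multiset.card_zero, pow_zero, one_mul]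
        nlinarith [mul_pos (neg_pos.mpr h) key]
      · simp only [Complex.ofReal_re, h, if_true]
        simp only [coeff_sub, coeff_X_zero, coeff_C_zero, zero_sub, Multiset.card_singleton,
          pow_one]
        nlinarith [mul_pos h key]
    · obtain ⟨r, rfl⟩ := quadratic_dvd_of_aeval_eq_zero_im_ne_zero q hz' him
      have hsm : (X ^ 2 - C (2 * z.re) * X + C (‖z‖ ^ 2) : ℝ[X]).Monic := by
        monicity!
      have hsd : (X ^ 2 - C (2 * z.re) * X + C (‖z‖ ^ 2) : ℝ[X]).natDegree = 2 := by
        compute_degree!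
      have hr : r.Monic := hsm.of_mul_monic_left hq
      have hdegr : r.natDegree < n := by
        rw [← hn, hsm.natDegree_mul hr, hsd]
        omega
      rw [mul_coeff_zero] at h0 ⊢
      have key := ih _ hdegr hr (right_ne_zero_of_mul h0) rfl
      have hz0 : z ≠ 0 := fun h => him (by simp [h])
      have hmap : ((X ^ 2 - C (2 * z.re) * X + C (‖z‖ ^ 2)) * r).map (algebraMap ℝ ℂ) =
          (X - C ((starRingEnd ℂ) z)) * (X - C z) * r.map (algebraMap ℝ ℂ) := by
        rw [Polynomial.map_mul]
        congr 1
        calc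
          _ = X ^ 2 - C (↑(2 * z.re) : ℂ) * X + C (‖z‖ ^ 2 : ℂ) := by simp
          _ = _ := by
            rw [← Complex.add_conj, map_add, ← Complex.mul_conj', map_mul]
            ring
      have hne₂ : (X - C ((starRingEnd ℂ) z)) * (X - C z) ≠ 0 :=
        mul_ne_zero (X_sub_C_ne_zero _) (X_sub_C_ne_zero _)
      have hne := mul_ne_zero hne₂ (hr.map (algebraMap ℝ ℂ)).ne_zero
      have hs0 : (X ^ 2 - C (2 * z.re) * X + C (‖z‖ ^ 2) : ℝ[X]).coeff 0 = ‖z‖ ^ 2 := by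
        simp [coeff_zero_eq_eval_zero]
      rw [hmap, roots_mul hne, roots_mul hne₂, roots_X_sub_C, roots_X_sub_C, hs0, mul_assoc]
      refine mul_pos (by positivity) ?_
      by_cases hre : 0 < z.re <;> simpa [Multiset.filter_singleton, hre, pow_add] using key

/-- The nonzero entries are exactly those on the first sub- and superdiagonal. -/
def IsStrictTridiagonal {R : Type*} [Zero R] {n : ℕ} (B : Matrix (Fin n) (Fin n) R) : Prop :=
  ∀ i j : Fin n, B i j ≠ 0 ↔ ((i : ℕ) + 1 = j ∨ (j : ℕ) + 1 = i)

namespace IsStrictTridiagonal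

theorem submatrix_succ {R : Type*} [Zero R] {n : ℕ} {B : Matrix (Fin (n + 1)) (Fin (n + 1)) R}
    (h : IsStrictTridiagonal B) : IsStrictTridiagonal (B.submatrix Fin.succ Fin.succ) := by
  intro i j
  simp [h i.succ j.succ]

theorem charpoly_eq {R : Type*} [CommRing R] {n : ℕ}
    {B : Matrix (Fin (n + 2)) (Fin (n + 2)) R} (h : IsStrictTridiagonal B) :
    B.charpoly = X * (B.submatrix Fin.succ Fin.succ).charpoly -
      C (B 0 1 * B 1 0) *
        ((B.submatrix Fin.succ Fin.succ).submatrix Fin.succ Fin.succ).charpoly := by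
  have hz : ∀ i j : Fin (n + 2), ¬((i : ℕ) + 1 = j ∨ (j : ℕ) + 1 = i) → B i j = 0 :=
    fun i j hij => by_contra fun hne => hij ((h i j).mp hne)
  have hsub : ∀ {m : ℕ} (A : Matrix (Fin (m + 1)) (Fin (m + 1)) R),
      (charmatrix A).submatrix Fin.succ Fin.succ = charmatrix (A.submatrix Fin.succ Fin.succ) := by
    intro m A
    ext i j : 2
    by_cases hij : i = j
    · subst hij; simp
    · simp [charmatrix_apply_ne _ _ _ hij, charmatrix_apply_ne _ _ _ ((Fin.succ_injective _).ne hij)]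
  have hminor : ((charmatrix B).submatrix Fin.succ (Fin.succAbove 1)).det =
      -C (B 1 0) * ((B.submatrix Fin.succ Fin.succ).submatrix Fin.succ Fin.succ).charpoly := by
    rw [det_succ_column_zero, Fin.sum_univ_succ, Finset.sum_eq_zero]
    · have : ((charmatrix B).submatrix Fin.succ (Fin.succAbove 1)).submatrix
          (Fin.succAbove 0) Fin.succ =
          ((charmatrix B).submatrix Fin.succ Fin.succ).submatrix Fin.succ Fin.succ := by
        ext i j : 2
        simp
      rw [this, hsub, hsub]
      simp [charpoly, charmatrix_apply_ne]
    · intro i _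
      have : B i.succ.succ 0 = 0 := hz _ _ (by simp)
      simp [charmatrix_apply_ne, this]
  rw [charpoly, det_succ_row_zero, Fin.sum_univ_succ, Fin.sum_univ_succ, Finset.sum_eq_zero]
  · have h00 : B 0 0 = 0 := hz _ _ (by simp)
    have h1 : Fin.succ (0 : Fin (n + 1)) = 1 := rfl
    rw [h1, hminor]
    simp only [Fin.succAbove_zero, hsub]
    simp [charmatrix_apply_ne, h00, charpoly]
    ring
  · intro i _
    have : B 0 i.succ.succ = 0 := hz _ _ (by simp)
    simp [charmatrix_apply_ne _ _ _ (Fin.succ_ne_zero _).symm, this]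

theorem charpoly_coeff_zero_eq_zero_iff {R : Type*} [CommRing R] [IsDomain R] :
    ∀ {n : ℕ} {B : Matrix (Fin n) (Fin n) R}, IsStrictTridiagonal B →
      (B.charpoly.coeff 0 = 0 ↔ Odd n)
  | 0, B, _ => by simp [charpoly]
  | 1, B, h => by
    have : B 0 0 = 0 := by_contra fun hne => by simpa using (h 0 0).mp hne
    simp [charpoly, this]
  | n + 2, B, h => by
    have h01 : B 0 1 ≠ 0 := (h 0 1).mpr (by simp)
    have h10 : B 1 0 ≠ 0 := (h 1 0).mpr (by simp)
    rw [h.charpoly_eq, coeff_sub, mul_coeff_zero, mul_coeff_zero]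
    rw [coeff_X_zero, zero_mul, zero_sub, neg_eq_zero, coeff_C_zero, mul_eq_zero,
      or_iff_right (mul_ne_zero h01 h10),
      charpoly_coeff_zero_eq_zero_iff h.submatrix_succ.submatrix_succ]
    simp [Nat.odd_add]

end IsStrictTridiagonal

/-- An irreducible tridiagonal sign pattern with a `0`-diagonal that allows a repeated zero
eigenvalue does not require a unique inertia. -/
theorem tridiagonal_repeated_zero_not_unique_inertia (n : ℕ) (hn : 2 ≤ n)
    (P : Matrix (Fin n) (Fin n) SignType)
    (htri : ∀ i j : Fin n, P i j ≠ 0 ↔ ((i : ℕ) + 1 = j ∨ (j : ℕ) + 1 = i))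
    (hrep : ∃ B, QClass P B ∧
      2 ≤ (B.charpoly.map (algebraMap ℝ ℂ)).rootMultiplicity 0) :
    ∃ B₁ B₂, QClass P B₁ ∧ QClass P B₂ ∧ inertia B₁ ≠ inertia B₂ := by
  obtain ⟨B, hB, hmult⟩ := hrep
  obtain ⟨n, rfl⟩ : ∃ m, n = m + 2 := ⟨n - 2, by omega⟩
  let A : ℝ → Matrix (Fin (n + 2)) (Fin (n + 2)) ℝ :=
    fun t => of fun i j => if i = 0 then t * B i j else B i j
  have hA : ∀ t, 0 < t → QClass P (A t) := by
    intro t ht i j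
    rw [← hB i j]
    by_cases hi : i = 0 <;> simp [A, hi, sign_mul, ht]
  have htriA : ∀ t, 0 < t → IsStrictTridiagonal (A t) := by
    intro t ht i j
    rw [← htri, ← hA t ht i j, ne_eq, ne_eq, sign_eq_zero_iff]
  have hA1 : A 1 = B := by
    ext i j
    simp [A]
  have htriB : IsStrictTridiagonal B := hA1 ▸ htriA 1 one_pos
  have hBdvd : X ^ 2 ∣ B.charpoly := by
    rw [← map_dvd_map' (algebraMap ℝ ℂ)]
    have hne := (B.charpoly_monic.map (algebraMap ℝ ℂ)).ne_zero
    simpa using (le_rootMultiplicity_iff hne).mp hmult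
  have hc0 : B.charpoly.coeff 0 = 0 := X_pow_dvd_iff.mp hBdvd 0 (by norm_num)
  have hc1 : B.charpoly.coeff 1 = 0 := X_pow_dvd_iff.mp hBdvd 1 (by norm_num)
  have hodd := htriB.charpoly_coeff_zero_eq_zero_iff.mp hc0
  set a := (B.submatrix Fin.succ Fin.succ).charpoly.coeff 0 with ha_def
  have ha : a ≠ 0 := by
    rw [ha_def, Ne, htriB.submatrix_succ.charpoly_coeff_zero_eq_zero_iff]
    intro h
    exact (Nat.not_even_iff_odd.mpr hodd) h.add_one
  have hcoeff : ∀ t, 0 < t → (A t).charpoly.coeff 1 = (1 - t) * a := by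
    intro t ht
    have hsub : (A t).submatrix Fin.succ Fin.succ = B.submatrix Fin.succ Fin.succ := by
      ext i j
      simp [A]
    rw [htriB.charpoly_eq, coeff_sub, coeff_X_mul, coeff_C_mul] at hc1
    rw [(htriA t ht).charpoly_eq, hsub, coeff_sub, coeff_X_mul, coeff_C_mul]
    simp only [A, of_apply, if_true, one_ne_zero, if_false]
    linear_combination t * hc1
  have hsign : ∀ t, 0 < t → t ≠ 1 → 0 < (1 - t) * a * (-1) ^ (inertia (A t)).1 := by
    intro t ht ht1
    have h0 : (A t).charpoly.coeff 0 = 0 :=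
      (htriA t ht).charpoly_coeff_zero_eq_zero_iff.mpr hodd
    obtain ⟨q, hq⟩ := X_dvd_iff.mpr h0
    have hqm : q.Monic := monic_X.of_mul_monic_left (hq ▸ (A t).charpoly_monic)
    have hq0 : q.coeff 0 = (1 - t) * a := by rw [← hcoeff t ht, hq, coeff_X_mul]
    have hne : X * q.map (algebraMap ℝ ℂ) ≠ 0 := mul_ne_zero X_ne_zero (hqm.map _).ne_zero
    have key := coeff_zero_mul_neg_one_pow_card_roots_pos hqm
      (hq0 ▸ mul_ne_zero (sub_ne_zero.mpr ht1.symm) ha)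
    rw [hq0] at key
    simpa [inertia, charRoots, hq, roots_mul hne, Multiset.filter_singleton] using key
  refine ⟨A 2, A (1 / 2), hA _ (by norm_num), hA _ (by norm_num), fun heq => ?_⟩
  have h2 := hsign 2 (by norm_num) (by norm_num)
  have h1 := hsign (1 / 2) (by norm_num) (by norm_num)
  rw [heq] at h2
  nlinarith
end

section
/- Let B and B′ be real n×n matrices with zero diagonal such that for all i, j: B i j ≠ 0 if and only if B′ i j ≠ 0, and |B i j| = |B′ i j|. Suppose the simple graph on {0,…,n−1} with i adjacent to j iff i ≠ j and B i j ≠ 0 is a tree, and suppose that for every edge {i,j} of this graph, B′ i j · B′ j i = −(B i j · B j i). Then for every λ ∈ ℂ, the multiplicity of λ as a root of the characteristic polynomial of B over ℂ equals the multiplicity of i·λ (where i is the imaginary unit) as a root of the characteristic polynomial of B′ over ℂ. -/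
open Polynomial Matrix

/-- On a tree, every group-valued edge labelling that inverts when the edge is reversed is the
coboundary of a vertex labelling. -/
theorem SimpleGraph.IsTree.exists_potential {V A : Type*} [Group A] {G : SimpleGraph V}
    (hG : G.IsTree) (r : V → V → A) (hr : ∀ u v, G.Adj u v → r u v * r v u = 1) :
    ∃ d : V → A, ∀ u v, G.Adj u v → d v = d u * r u v := by
  obtain ⟨root⟩ := hG.connected.nonempty
  choose p hp _ using hG.existsUnique_path root
  have step (u v : V) (h : G.Adj u v) (hu : u ∈ (p v).support) :
      ((p v).darts.map fun e ↦ r e.fst e.snd).prod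
        = ((p u).darts.map fun e ↦ r e.fst e.snd).prod * r u v := by
    rw [hG.isAcyclic.path_concat (hp u) (hp v) h hu]
    simp [SimpleGraph.Walk.darts_concat]
  refine ⟨fun v ↦ ((p v).darts.map fun e ↦ r e.fst e.snd).prod, fun u v h ↦ ?_⟩
  by_cases hv : v ∈ (p u).support
  · simp only [step v u h.symm hv, mul_assoc, hr v u h.symm, mul_one]
  · exact step u v h (hG.isAcyclic.mem_support_of_ne_mem_support_of_adj_of_isPath
      (hp v) (hp u) h.symm hv)

theorem Matrix.charpoly_smul_comp_C_mul_X {ι R : Type*} [Fintype ι] [DecidableEq ι] [CommRing R]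
    (c : R) (M : Matrix ι ι R) :
    (c • M).charpoly.comp (C c * X) = C (c ^ Fintype.card ι) * M.charpoly := by
  rw [charpoly, charpoly, ← coe_compRingHom_apply, RingHom.map_det, C_pow, ← det_smul]
  congr 1
  ext1 i j
  by_cases h : i = j
  · subst h
    simp [mul_sub]
  · simp [h]

theorem Matrix.rootMultiplicity_charpoly_smul {ι K : Type*} [Fintype ι] [DecidableEq ι] [Field K]
    {c : K} (hc : c ≠ 0) (M : Matrix ι ι K) (z : K) :
    (c • M).charpoly.rootMultiplicity (c * z) = M.charpoly.rootMultiplicity z := by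
  have h := rootMultiplicity_comp_C_mul_X_add_C (c • M).charpoly c 0 z hc.isUnit
  rw [C_0, add_zero, add_zero, charpoly_smul_comp_C_mul_X, rootMultiplicity_mul
    (mul_ne_zero (C_ne_zero.2 (pow_ne_zero _ hc)) M.charpoly_monic.ne_zero),
    rootMultiplicity_C, zero_add] at h
  exact h.symm

theorem Matrix.charpoly_eq_of_forall_mul_eq_mul {ι R : Type*} [Fintype ι] [DecidableEq ι]
    [CommRing R] {M N : Matrix ι ι R} (d : ι → Rˣ) (h : ∀ i j, d i * N i j = M i j * d j) :
    N.charpoly = M.charpoly := by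
  let D : (Matrix ι ι R)ˣ :=
    ⟨diagonal fun i ↦ d i, diagonal fun i ↦ ↑(d i)⁻¹, by simp, by simp⟩
  have hD : D.val * N = M * D.val := by
    ext i j
    simpa [D, diagonal_mul, mul_diagonal] using h i j
  rw [← charpoly_units_conj D N, hD, mul_assoc, ← coe_units_inv, Units.mul_inv, mul_one]

/-- Let `B` and `B'` be real matrices with zero diagonal, the same zero pattern and the same
absolute values of entries, with the underlying graph of `B` a tree, and suppose that the sign
of every edge product is reversed between `B` and `B'`.  Then the multiplicity of `z` as a
root of the characteristic polynomial of `B` equals the multiplicity of `I * z` as a root of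
the characteristic polynomial of `B'`. -/
theorem tree_matrix_negation_eigen (n : ℕ) (B B' : Matrix (Fin n) (Fin n) ℝ)
    (hdiag : ∀ i, B i i = 0) (hdiag' : ∀ i, B' i i = 0)
    (hzero : ∀ i j, B i j ≠ 0 ↔ B' i j ≠ 0)
    (habs : ∀ i j, |B i j| = |B' i j|)
    (htree : (SimpleGraph.fromRel (fun i j : Fin n => B i j ≠ 0)).IsTree)
    (hneg : ∀ i j, (SimpleGraph.fromRel (fun i j : Fin n => B i j ≠ 0)).Adj i j →
      B' i j * B' j i = -(B i j * B j i))
    (z : ℂ) :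
    (B.charpoly.map (algebraMap ℝ ℂ)).rootMultiplicity z
      = (B'.charpoly.map (algebraMap ℝ ℂ)).rootMultiplicity (Complex.I * z) := by
  have hI := Complex.I_ne_zero
  have hratio (i j : Fin n) (h : B i j ≠ 0) : (B' i j : ℂ) / (Complex.I * B i j) ≠ 0 :=
    div_ne_zero (by exact_mod_cast (hzero i j).1 h) (mul_ne_zero hI (by exact_mod_cast h))
  let r (i j : Fin n) : ℂˣ :=
    if h : B i j ≠ 0 then Units.mk0 _ (hratio i j h)
    else if h : B j i ≠ 0 then (Units.mk0 _ (hratio j i h))⁻¹ else 1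
  have hr (i j : Fin n) (hadj : (SimpleGraph.fromRel (fun i j : Fin n => B i j ≠ 0)).Adj i j) :
      r i j * r j i = 1 := by
    by_cases hij : B i j = 0 <;> by_cases hji : B j i = 0 <;> simp only [r, hij, hji, ne_eq,
      not_true_eq_false, not_false_eq_true, dite_true, dite_false, mul_one,
      inv_mul_cancel, mul_inv_cancel]
    have hprod : (B' i j : ℂ) * B' j i = -(B i j * B j i) := by exact_mod_cast hneg i j hadj
    have hij' : (B i j : ℂ) ≠ 0 := by exact_mod_cast hij
    have hji' : (B j i : ℂ) ≠ 0 := by exact_mod_cast hji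
    ext
    simp only [Units.val_mul, Units.val_mk0, Units.val_one]
    rw [div_mul_div_comm, hprod, div_eq_one_iff_eq (by simp [hij', hji'])]
    linear_combination (-(B i j * B j i : ℂ)) * Complex.I_mul_I
  obtain ⟨d, hd⟩ := htree.exists_potential r hr
  have hsimilar : (B'.map (algebraMap ℝ ℂ)).charpoly
      = (Complex.I • B.map (algebraMap ℝ ℂ)).charpoly := by
    refine charpoly_eq_of_forall_mul_eq_mul d fun i j ↦ ?_
    by_cases hij : B i j = 0
    · have hij' : B' i j = 0 := by simpa [hij] using hzero i j
      simp [hij, hij']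
    · have hadj : (SimpleGraph.fromRel (fun i j : Fin n => B i j ≠ 0)).Adj i j :=
        (SimpleGraph.fromRel_adj _ _ _).2 ⟨fun h ↦ hij (h ▸ hdiag i), Or.inl hij⟩
      have hij' : (B i j : ℂ) ≠ 0 := by exact_mod_cast hij
      simp only [hd i j hadj, r, hij, ne_eq, not_false_eq_true, dite_true, Units.val_mul,
        Units.val_mk0, map_apply, Matrix.smul_apply, smul_eq_mul, Complex.coe_algebraMap]
      field_simp
  rw [← charpoly_map, ← charpoly_map, hsimilar, rootMultiplicity_charpoly_smul hI]
end

section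
/- Let P be an irreducible tridiagonal sign pattern with 0-diagonal of order n ≥ 2, with edge signs s k = P k (k+1) · P (k+1) k for k = 0,…,n−2. Call a pair (a,b) with 0 ≤ a ≤ b ≤ n−2 a maximal signed run if s k = s a for all a ≤ k ≤ b, s (a−1) ≠ s a whenever a > 0, and s (b+1) ≠ s b whenever b < n−2; its length is b − a + 1. If P requires a unique inertia, then there is at most one maximal signed run of odd length. -/
open Polynomial Matrix

/-- `(a, b)` is a maximal signed run of the sequence of edge signs `s 0, …, s (n-2)`. -/
def MaximalSignedRun (n : ℕ) (s : ℕ → SignType) (a b : ℕ) : Prop :=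
  a ≤ b ∧ b ≤ n - 2 ∧ (∀ k, a ≤ k → k ≤ b → s k = s a) ∧
    (0 < a → s (a - 1) ≠ s a) ∧ (b < n - 2 → s (b + 1) ≠ s b)

open Filter Topology

lemma eventually_charpoly_eq_prod {ι : Type*} [Fintype ι] [DecidableEq ι]
    (M : ℝ → Matrix ι ι ℝ) (hM : Continuous M) (d : ι → ℝ) (hd : M 0 = diagonal d)
    (hinj : Function.Injective d) :
    ∀ᶠ ε in 𝓝 (0 : ℝ), ∃ ρ : ι → ℝ, (M ε).charpoly = ∏ i, (X - C (ρ i)) ∧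
      ∀ i, (0 < d i → 0 < ρ i) ∧ (d i < 0 → ρ i < 0) := by
  have hsmall : ∀ c : ℝ, c ≠ 0 → ∀ᶠ δ in 𝓝[>] (0 : ℝ), 2 * δ < |c| := fun c hc => by
    have : Tendsto (fun δ : ℝ => 2 * δ) (𝓝[>] 0) (𝓝 0) :=
      (Continuous.tendsto' (by fun_prop) _ _ (by simp)).mono_left nhdsWithin_le_nhds
    exact this.eventually_lt_const (abs_pos.mpr hc)
  obtain ⟨δ, hsep, hzero, hδ⟩ : ∃ δ : ℝ, (∀ i j, i ≠ j → 2 * δ < |d i - d j|) ∧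
      (∀ i, d i ≠ 0 → 2 * δ < |d i|) ∧ 0 < δ := by
    refine Eventually.exists (f := 𝓝[>] (0 : ℝ)) (Eventually.and ?_ (Eventually.and ?_ ?_))
    · refine eventually_all.mpr fun i => eventually_all.mpr fun j => ?_
      by_cases hij : i = j
      · simp [hij]
      · exact (hsmall _ (sub_ne_zero.mpr (hinj.ne hij))).mono fun _ h _ => h
    · refine eventually_all.mpr fun i => ?_
      by_cases hi : d i = 0
      · simp [hi]
      · exact (hsmall _ hi).mono fun _ h _ => h
    · exact self_mem_nhdsWithin
  have hcont : ∀ y : ℝ, Continuous fun ε => (M ε).charpoly.eval y := fun y => by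
    simp only [Matrix.eval_charpoly]
    exact (continuous_const.sub hM).matrix_det
  have hneg : ∀ᶠ ε in 𝓝 (0 : ℝ), ∀ i,
      (M ε).charpoly.eval (d i - δ) * (M ε).charpoly.eval (d i + δ) < 0 := by
    refine eventually_all.mpr fun i => ?_
    refine ContinuousAt.eventually_lt ((hcont _).mul (hcont _)).continuousAt continuousAt_const ?_
    simp only [hd, charpoly_diagonal, eval_prod, eval_sub, eval_X, eval_C]
    rw [← Finset.prod_mul_distrib, ← Finset.mul_prod_erase _ _ (Finset.mem_univ i)]
    refine mul_neg_of_neg_of_pos (by nlinarith) (Finset.prod_pos fun j hj => ?_)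
    have h := hsep i j (Finset.ne_of_mem_erase hj).symm
    have h2 := sq_abs (d i - d j)
    nlinarith
  filter_upwards [hneg] with ε hε
  have hroot : ∀ i, ∃ r, d i - δ < r ∧ r < d i + δ ∧ (M ε).charpoly.IsRoot r := fun i => by
    have hc : ContinuousOn (fun y => (M ε).charpoly.eval y) (Set.Icc (d i - δ) (d i + δ)) :=
      (M ε).charpoly.continuous.continuousOn
    have hle : d i - δ ≤ d i + δ := by linarith
    rcases mul_neg_iff.mp (hε i) with ⟨h1, h2⟩ | ⟨h1, h2⟩
    · obtain ⟨r, hr, hr0⟩ := intermediate_value_Ioo' hle hc ⟨h2, h1⟩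
      exact ⟨r, hr.1, hr.2, hr0⟩
    · obtain ⟨r, hr, hr0⟩ := intermediate_value_Ioo hle hc ⟨h1, h2⟩
      exact ⟨r, hr.1, hr.2, hr0⟩
  choose ρ h1 h2 h3 using hroot
  have hρ : Function.Injective ρ := fun i j hij => by
    by_contra hne
    have := hsep i j hne
    have := h1 i; have := h2 i; have := h1 j; have := h2 j
    have : |d i - d j| ≤ 2 * δ := abs_le.mpr ⟨by linarith, by linarith⟩
    linarith
  refine ⟨ρ, ?_, fun i => ⟨fun hi => ?_, fun hi => ?_⟩⟩
  · refine (Polynomial.eq_of_monic_of_associated (monic_prod_X_sub_C _ _) (M ε).charpoly_monic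
      ?_).symm
    refine associated_of_dvd_of_natDegree_le ?_ (M ε).charpoly_monic.ne_zero ?_
    · exact Finset.prod_dvd_of_coprime
        (fun i _ j _ hij => pairwise_coprime_X_sub_C hρ hij)
        fun i _ => dvd_iff_isRoot.mpr (h3 i)
    · simp [natDegree_finsetProd_X_sub_C_eq_card]
  · have := hzero i hi.ne'
    rw [abs_of_pos hi] at this
    linarith [h1 i]
  · have := hzero i hi.ne
    rw [abs_of_neg hi] at this
    linarith [h2 i]

lemma charpoly_mul_X_pow_of_bipartite {V R : Type*} [Fintype V] [DecidableEq V] [CommRing R]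
    (p : V → Prop) [DecidablePred p] (B : Matrix V V R) (hB : ∀ i j, (p i ↔ p j) → B i j = 0) :
    B.charpoly * X ^ Fintype.card {i // p i} =
      X ^ Fintype.card {i // ¬ p i} * ((B * B).toBlock p p).charpoly.comp (X ^ 2) := by
  set E := (B.toBlock p fun i => ¬ p i).map (C : R →+* R[X])
  set F := (B.toBlock (fun i => ¬ p i) p).map (C : R →+* R[X])
  have hsq : (B * B).toBlock p p =
      B.toBlock p (fun i => ¬ p i) * B.toBlock (fun i => ¬ p i) p := by
    rw [toBlock_mul_eq_add p p p]
    have : B.toBlock p p = 0 := by ext i j; exact hB _ _ (by simp [i.2, j.2])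
    simp [this]
  have hblock : B.charpoly = (fromBlocks (scalar _ X) (-E) (-F) (scalar _ X)).det := by
    rw [charpoly, det_toBlock _ p]
    congr 1
    ext (i | i) (j | j)
    · by_cases hij : i = j <;>
        simp [charmatrix_apply, diagonal_apply, Subtype.ext_iff, hB i j (by simp [i.2, j.2])]
    · have hij : (i : V) ≠ j := fun h => j.2 (h ▸ i.2)
      simp [hij, E]
    · have hij : (i : V) ≠ j := fun h => i.2 (h ▸ j.2)
      simp [hij, F]
    · by_cases hij : i = j <;>
        simp [charmatrix_apply, diagonal_apply, Subtype.ext_iff, hB i j (by simp [i.2, j.2])]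
  have hcomp : ((B * B).toBlock p p).charpoly.comp (X ^ 2) =
      (scalar _ (X ^ 2) - E * F).det := by
    rw [hsq, charpoly, ← Polynomial.coe_compRingHom_apply, RingHom.map_det]
    congr 1
    ext i j
    by_cases hij : i = j <;>
    simp [hij, mul_apply, E, F, Polynomial.sum_comp]
  have hmul : fromBlocks (scalar _ X) (-E) (-F) (scalar _ X) *
      fromBlocks (scalar _ X) 0 F 1 =
      fromBlocks (scalar _ (X ^ 2) - E * F) (-E) 0 (scalar _ X) := by
    rw [fromBlocks_multiply]
    congr 1
    · rw [← map_mul, ← sq, sub_eq_add_neg, Matrix.neg_mul]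
    · simp
    · simp only [scalar_apply]
      ext i j
      simp [mul_comm]
    · simp
  have := congrArg det hmul
  rw [det_mul, det_fromBlocks_zero₁₂, det_fromBlocks_zero₂₁, ← hblock, ← hcomp] at this
  simpa [mul_comm] using this

lemma card_filter_re_pos_roots_X_sq_sub_C (r : ℝ) :
    (((X ^ 2 - C (r : ℂ)).roots.filter fun z : ℂ => 0 < z.re)).card = if 0 < r then 1 else 0 := by
  have hfac : ∀ w : ℂ, w ^ 2 = r → (X ^ 2 - C (r : ℂ)).roots = {w, -w} := fun w hw => by
    have : (X ^ 2 - C (r : ℂ)) = (({w, -w} : Multiset ℂ).map fun a => X - C a).prod := by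
      simp [← hw]; ring
    rw [this, roots_multiset_prod_X_sub_C]
  split_ifs with h
  · rw [hfac (√r : ℝ) (by exact_mod_cast Real.sq_sqrt h.le)]
    simp [Multiset.insert_eq_cons, Multiset.filter_singleton, h,
      (Real.sqrt_nonneg r).not_gt]
  · rw [hfac ((√(-r) : ℝ) * Complex.I) (by
      rw [mul_pow, Complex.I_sq]
      have := Real.sq_sqrt (x := -r) (by linarith)
      rw [← Complex.ofReal_pow, this]; simp)]
    simp [Multiset.insert_eq_cons, Multiset.filter_singleton]

lemma inertia_fst_eq_card {n : ℕ} (p : Fin n → Prop) [DecidablePred p]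
    (B : Matrix (Fin n) (Fin n) ℝ) (hB : ∀ i j, (p i ↔ p j) → B i j = 0)
    (ρ : {i // p i} → ℝ) (hρ : ((B * B).toBlock p p).charpoly = ∏ i, (X - C (ρ i))) :
    (inertia B).1 = (Finset.univ.filter fun i => 0 < ρ i).card := by
  have h := congrArg (Polynomial.map (algebraMap ℝ ℂ)) (charpoly_mul_X_pow_of_bipartite p B hB)
  rw [hρ, prod_comp] at h
  simp only [Polynomial.map_mul, Polynomial.map_pow, Polynomial.map_X, Polynomial.map_prod,
    sub_comp, X_comp, C_comp, Polynomial.map_sub, map_C] at h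
  have hX : ∀ r : ℝ, (X ^ 2 - C (algebraMap ℝ ℂ r)) ≠ 0 := fun r =>
    (monic_X_pow_sub_C _ two_ne_zero).ne_zero
  have hprod : ∏ i, (X ^ 2 - C (algebraMap ℝ ℂ (ρ i))) ≠ 0 :=
    Finset.prod_ne_zero_iff.mpr fun i _ => hX _
  have hB0 : B.charpoly.map (algebraMap ℝ ℂ) ≠ 0 :=
    (B.charpoly_monic.map _).ne_zero
  have h := congrArg (fun q : ℂ[X] => (q.roots.filter fun z : ℂ => 0 < z.re).card) h
  rw [roots_mul (mul_ne_zero hB0 (pow_ne_zero _ X_ne_zero)),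
    roots_mul (mul_ne_zero (pow_ne_zero _ X_ne_zero) hprod), roots_X_pow, roots_X_pow,
    roots_prod _ _ hprod] at h
  simp only [Multiset.filter_add, Multiset.card_add, Multiset.filter_nsmul,
    Multiset.filter_singleton, Complex.zero_re, lt_irrefl, if_false, Multiset.card_nsmul,
    Multiset.empty_eq_zero, Multiset.card_zero, mul_zero, add_zero, zero_add] at h
  rw [inertia, charRoots]
  refine h.trans ?_
  rw [Multiset.filter_bind, Multiset.card_bind, Finset.card_filter]
  exact congrArg Multiset.sum
    (Multiset.map_congr rfl fun i _ => card_filter_re_pos_roots_X_sq_sub_C (ρ i))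

lemma eq_of_sign_mul_sq_eq {σ τ : SignType} (hσ : σ ≠ 0) (hτ : τ ≠ 0) {x y : ℕ}
    (h : (σ : ℝ) * (x : ℝ) ^ 2 = τ * (y : ℝ) ^ 2) : x = y := by
  have habs : ∀ {υ : SignType}, υ ≠ 0 → |(υ : ℝ)| = 1 := by
    intro υ hυ
    cases υ <;> simp_all
  have := congrArg abs h
  rw [abs_mul, abs_mul, habs hσ, habs hτ] at this
  simp only [one_mul, abs_pow, Nat.abs_cast] at this
  exact_mod_cast (pow_left_inj₀ (Nat.cast_nonneg x) (Nat.cast_nonneg y) two_ne_zero).mp this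

/-- The matrix with the signs of `P` in which both entries of the edge `{k, k + 1}` have
magnitude `a k`. -/
noncomputable def weightedPattern {n : ℕ} (P : Matrix (Fin n) (Fin n) SignType) (a : ℕ → ℝ) :
    Matrix (Fin n) (Fin n) ℝ :=
  of fun i j => (P i j : ℝ) * a (min (i : ℕ) j)

lemma qClass_weightedPattern {n : ℕ} (P : Matrix (Fin n) (Fin n) SignType) {a : ℕ → ℝ}
    (ha : ∀ k, 0 < a k) : QClass P (weightedPattern P a) := fun i j => by
  simp only [weightedPattern, of_apply, sign_mul, sign_pos (ha _), mul_one]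
  cases P i j <;> simp

lemma adj_of_weightedPattern_ne_zero {n : ℕ} {P : Matrix (Fin n) (Fin n) SignType}
    (htri : ∀ i j : Fin n, P i j ≠ 0 ↔ ((i : ℕ) + 1 = j ∨ (j : ℕ) + 1 = i))
    {a : ℕ → ℝ} {i j : Fin n} (h : weightedPattern P a i j ≠ 0) :
    (i : ℕ) + 1 = j ∧ a i ≠ 0 ∨ (j : ℕ) + 1 = i ∧ a j ≠ 0 := by
  simp only [weightedPattern, of_apply] at h
  have h1 := right_ne_zero_of_mul h
  rcases (htri i j).mp fun h0 => h (by simp [h0]) with h2 | h2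
  · exact .inl ⟨h2, by rwa [min_eq_left (by omega)] at h1⟩
  · exact .inr ⟨h2, by rwa [min_eq_right (by omega)] at h1⟩

lemma weightedPattern_apply_eq_zero {n : ℕ} {P : Matrix (Fin n) (Fin n) SignType}
    (htri : ∀ i j : Fin n, P i j ≠ 0 ↔ ((i : ℕ) + 1 = j ∨ (j : ℕ) + 1 = i))
    (a : ℕ → ℝ) (i j : Fin n) (h : Odd (i : ℕ) ↔ Odd (j : ℕ)) : weightedPattern P a i j = 0 := by
  by_contra hne
  rcases adj_of_weightedPattern_ne_zero htri hne with ⟨h1, -⟩ | ⟨h1, -⟩ <;>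
  · rw [← h1] at h
    grind

lemma toBlock_odd_weightedPattern_sq {n : ℕ} {P : Matrix (Fin n) (Fin n) SignType}
    (htri : ∀ i j : Fin n, P i j ≠ 0 ↔ ((i : ℕ) + 1 = j ∨ (j : ℕ) + 1 = i))
    {s : ℕ → SignType}
    (hs : ∀ k : ℕ, (hk : k + 1 < n) →
      s k = P ⟨k, Nat.lt_of_succ_lt hk⟩ ⟨k + 1, hk⟩ * P ⟨k + 1, hk⟩ ⟨k, Nat.lt_of_succ_lt hk⟩)
    {a : ℕ → ℝ} (hlt : ∀ k, a k ≠ 0 → k + 1 < n) (hmatch : ∀ k, a k ≠ 0 → a (k + 1) = 0) :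
    (weightedPattern P a * weightedPattern P a).toBlock
      (fun i : Fin n => Odd (i : ℕ)) (fun i => Odd (i : ℕ)) =
    diagonal fun v : {i : Fin n // Odd (i : ℕ)} =>
      (s ((v : Fin n) - 1) : ℝ) * a ((v : Fin n) - 1) ^ 2 + s (v : Fin n) * a (v : Fin n) ^ 2 := by
  have hmul : ∀ k (hk : k + 1 < n), weightedPattern P a ⟨k, Nat.lt_of_succ_lt hk⟩ ⟨k + 1, hk⟩ *
      weightedPattern P a ⟨k + 1, hk⟩ ⟨k, Nat.lt_of_succ_lt hk⟩ = (s k : ℝ) * a k ^ 2 := by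
    intro k hk
    rw [hs k hk]
    simp [weightedPattern]
    ring
  ext ⟨⟨u, hu⟩, hu'⟩ ⟨⟨v, hv⟩, hv'⟩
  simp only [toBlock_apply, mul_apply, diagonal_apply, Subtype.mk.injEq, Fin.mk.injEq]
  have hnz : ∀ w : Fin n, weightedPattern P a ⟨u, hu⟩ w * weightedPattern P a w ⟨v, hv⟩ ≠ 0 →
      u = v ∧ ((w : ℕ) + 1 = u ∧ a w ≠ 0 ∨ (w : ℕ) = u + 1 ∧ a u ≠ 0) := by
    intro w hw
    rcases adj_of_weightedPattern_ne_zero htri (left_ne_zero_of_mul hw) with ⟨h1, h2⟩ | ⟨h1, h2⟩ <;>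
    rcases adj_of_weightedPattern_ne_zero htri (right_ne_zero_of_mul hw) with
      ⟨h3, h4⟩ | ⟨h3, h4⟩ <;>
    dsimp only at h1 h2 h3 h4
    · exact absurd (hmatch u h2) (by rwa [h1])
    · exact ⟨by omega, .inr ⟨h1.symm, h2⟩⟩
    · exact ⟨by omega, .inl ⟨h1, h2⟩⟩
    · exact absurd (hmatch v h4) (by rwa [h3])
  split_ifs with huv
  · subst huv
    obtain ⟨k, rfl⟩ : ∃ k, u = k + 1 := Nat.exists_eq_add_one.mpr hu'.pos
    rw [Nat.add_sub_cancel]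
    by_cases h1 : a k = 0
    · by_cases h2 : a (k + 1) = 0
      · rw [Finset.sum_eq_zero]
        · simp [h1, h2]
        · intro w _
          by_contra hne
          rcases (hnz w hne).2 with ⟨h3, h4⟩ | ⟨h3, h4⟩
          · exact h4 (by rwa [Nat.succ_injective h3])
          · exact h4 h2
      · rw [Finset.sum_eq_single (⟨k + 2, hlt _ h2⟩ : Fin n)]
        · rw [hmul (k + 1) (hlt _ h2)]
          simp [h1]
        · intro w _ hw
          by_contra hne
          rcases (hnz w hne).2 with ⟨h3, h4⟩ | ⟨h3, h4⟩
          · exact h4 (by rwa [Nat.succ_injective h3])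
          · exact hw (Fin.ext h3)
        · simp
    · rw [Finset.sum_eq_single (⟨k, by omega⟩ : Fin n)]
      · rw [mul_comm, hmul k hu]
        simp [hmatch k h1]
      · intro w _ hw
        by_contra hne
        rcases (hnz w hne).2 with ⟨h3, h4⟩ | ⟨h3, h4⟩
        · exact hw (Fin.ext (Nat.succ_injective h3))
        · exact h4 (hmatch k h1)
      · simp
  · refine Finset.sum_eq_zero fun w _ => ?_
    by_contra hne
    exact huv (hnz w hne).1

lemma edgeSign_ne_zero {n : ℕ} {P : Matrix (Fin n) (Fin n) SignType}
    (htri : ∀ i j : Fin n, P i j ≠ 0 ↔ ((i : ℕ) + 1 = j ∨ (j : ℕ) + 1 = i))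
    {s : ℕ → SignType}
    (hs : ∀ k : ℕ, (hk : k + 1 < n) →
      s k = P ⟨k, Nat.lt_of_succ_lt hk⟩ ⟨k + 1, hk⟩ * P ⟨k + 1, hk⟩ ⟨k, Nat.lt_of_succ_lt hk⟩)
    {k : ℕ} (hk : k + 1 < n) : s k ≠ 0 := by
  rw [hs k hk]
  exact mul_ne_zero ((htri _ _).mpr (by simp)) ((htri _ _).mpr (by simp))

/-- The edges `{k, k + 1}` with `act k` form a matching of the path on `n` vertices that leaves at
most one odd vertex uncovered. -/
structure IsNearCovering (n : ℕ) (act : ℕ → Prop) : Prop where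
  lt : ∀ k, act k → k + 1 < n
  matching : ∀ k, act k → ¬ act (k + 1)
  cover : ∀ u v, Odd u → Odd v → u < n → v < n → ¬ act (u - 1) → ¬ act u →
    ¬ act (v - 1) → ¬ act v → u = v

/-- Some active edge at the vertex `v` has sign `σ`. -/
def MeetsSign (s : ℕ → SignType) (act : ℕ → Prop) (σ : SignType) (v : ℕ) : Prop :=
  act (v - 1) ∧ s (v - 1) = σ ∨ act v ∧ s v = σ

/-- A near-covering matching bounds the number of eigenvalues with positive real part of some matrix
of the qualitative class: from below by the odd vertices covered by positive edges, from above by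
the odd vertices not covered by negative edges. -/
lemma exists_inertia_bounds {n : ℕ} {P : Matrix (Fin n) (Fin n) SignType}
    (htri : ∀ i j : Fin n, P i j ≠ 0 ↔ ((i : ℕ) + 1 = j ∨ (j : ℕ) + 1 = i))
    {s : ℕ → SignType}
    (hs : ∀ k : ℕ, (hk : k + 1 < n) →
      s k = P ⟨k, Nat.lt_of_succ_lt hk⟩ ⟨k + 1, hk⟩ * P ⟨k + 1, hk⟩ ⟨k, Nat.lt_of_succ_lt hk⟩)
    {act : ℕ → Prop} (hact : IsNearCovering n act) :
    ∃ B, QClass P B ∧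
      {v : {i : Fin n // Odd (i : ℕ)} | MeetsSign s act 1 (v : Fin n)}.ncard ≤ (inertia B).1 ∧
      (inertia B).1 ≤
        {v : {i : Fin n // Odd (i : ℕ)} | ¬ MeetsSign s act (-1) (v : Fin n)}.ncard := by
  classical
  set a : ℕ → ℝ := fun k => if act k then k + 1 else 0 with ha
  have haact : ∀ k, a k ≠ 0 → act k := fun k h => by
    by_contra hk
    exact h (if_neg hk)
  set d : {i : Fin n // Odd (i : ℕ)} → ℝ := fun v =>
    (s ((v : Fin n) - 1) : ℝ) * a ((v : Fin n) - 1) ^ 2 + s (v : Fin n) * a (v : Fin n) ^ 2 with hd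
  have hdiag := toBlock_odd_weightedPattern_sq htri hs (fun k hk => hact.lt k (haact k hk))
    fun k hk => if_neg (hact.matching k (haact k hk))
  have hmatch' : ∀ v : {i : Fin n // Odd (i : ℕ)},
      act ((v : Fin n) - 1) → ¬ act (v : Fin n) := fun v hv => by
    have := hact.matching _ hv
    rwa [Nat.sub_add_cancel v.2.pos] at this
  have hleft : ∀ v : {i : Fin n // Odd (i : ℕ)}, act ((v : Fin n) - 1) →
      d v = s ((v : Fin n) - 1) * ((v : Fin n) : ℕ) ^ 2 := fun v hv => by
    have h1 : (((v : Fin n) - 1 : ℕ) : ℝ) + 1 = ((v : Fin n) : ℕ) := by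
      exact_mod_cast Nat.sub_add_cancel v.2.pos
    simp [hd, ha, hv, hmatch' v hv, h1]
  have hright : ∀ v : {i : Fin n // Odd (i : ℕ)}, act (v : Fin n) →
      d v = s (v : Fin n) * (((v : Fin n) + 1 : ℕ) : ℝ) ^ 2 := fun v hv => by
    have h1 : ¬ act ((v : Fin n) - 1) := fun h => hmatch' v h hv
    simp [hd, ha, hv, h1]
  have hform : ∀ v : {i : Fin n // Odd (i : ℕ)}, ∃ σ : SignType, ∃ e : ℕ, σ ≠ 0 ∧
      d v = σ * (e : ℝ) ^ 2 ∧ (act ((v : Fin n) - 1) ∧ e = (v : Fin n) ∨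
        act (v : Fin n) ∧ e = (v : Fin n) + 1 ∨
        ¬ act ((v : Fin n) - 1) ∧ ¬ act (v : Fin n) ∧ e = 0) := fun v => by
    by_cases h1 : act ((v : Fin n) - 1)
    · exact ⟨_, _, edgeSign_ne_zero htri hs (hact.lt _ h1), hleft v h1, .inl ⟨h1, rfl⟩⟩
    · by_cases h2 : act (v : Fin n)
      · exact ⟨_, _, edgeSign_ne_zero htri hs (hact.lt _ h2), hright v h2, .inr (.inl ⟨h2, rfl⟩)⟩
      · exact ⟨1, 0, by decide, by simp [hd, ha, h1, h2], .inr (.inr ⟨h1, h2, rfl⟩)⟩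
  have hinj : Function.Injective d := by
    intro u v huv
    obtain ⟨σ, e, hσ, hde, hu⟩ := hform u
    obtain ⟨τ, f, hτ, hdf, hv⟩ := hform v
    rw [hde, hdf] at huv
    have hef := eq_of_sign_mul_sq_eq hσ hτ huv
    have hu' := u.2
    have hv' := v.2
    have huv' := hact.cover u v u.2 v.2 u.1.2 v.1.2
    refine Subtype.ext (Fin.ext ?_)
    rcases hu with ⟨-, hu⟩ | ⟨-, hu⟩ | ⟨hu1, hu2, hu⟩ <;>
    rcases hv with ⟨-, hv⟩ | ⟨-, hv⟩ | ⟨hv1, hv2, hv⟩ <;>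
    first
      | exact huv' hu1 hu2 hv1 hv2
      | (clear huv'; rw [Nat.odd_iff] at hu' hv'; omega)
  have hWcont : Continuous fun ε => weightedPattern P fun k => a k + ε := by
    refine continuous_matrix fun i j => ?_
    simp only [weightedPattern, of_apply]
    fun_prop
  obtain ⟨ε, ⟨ρ, hρ, hρd⟩, hε⟩ :=
    (((eventually_charpoly_eq_prod _ ((hWcont.matrix_mul hWcont).matrix_submatrix _ _) d
      (by simp only [add_zero]; exact hdiag) hinj).filter_mono
      nhdsWithin_le_nhds).and (self_mem_nhdsWithin (s := Set.Ioi (0 : ℝ)))).exists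
  have hin := inertia_fst_eq_card _ _ (weightedPattern_apply_eq_zero htri _) ρ hρ
  rw [← Set.ncard_coe_finset] at hin
  refine ⟨weightedPattern P fun k => a k + ε,
    qClass_weightedPattern P fun k => add_pos_of_nonneg_of_pos ?_ hε, ?_, ?_⟩
  · simp only [ha]
    split_ifs <;> positivity
  all_goals
    rw [hin]
    refine Set.ncard_le_ncard (fun v hv => ?_) (Set.toFinite _)
    have hv0 : (0 : ℝ) < ((v : Fin n) : ℕ) := by exact_mod_cast v.2.pos
    simp only [Finset.coe_filter, Finset.mem_univ, true_and, Set.mem_ofPred_eq] at hv ⊢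
  · refine (hρd v).1 ?_
    rcases hv with ⟨h1, h2⟩ | ⟨h1, h2⟩
    · rw [hleft v h1, h2]
      simp only [SignType.coe_one, one_mul]
      positivity
    · rw [hright v h1, h2]
      simp only [SignType.coe_one, one_mul]
      positivity
  · intro hv'
    refine ((hρd v).2 ?_).not_gt hv
    rcases hv' with ⟨h1, h2⟩ | ⟨h1, h2⟩
    · rw [hleft v h1, h2]
      simp only [SignType.coe_neg_one, neg_one_mul, neg_lt_zero]
      positivity
    · rw [hright v h1, h2]
      simp only [SignType.coe_neg_one, neg_one_mul, neg_lt_zero]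
      positivity

lemma not_meetsSign_neg_one_of_requiresUniqueInertia {n : ℕ}
    {P : Matrix (Fin n) (Fin n) SignType}
    (htri : ∀ i j : Fin n, P i j ≠ 0 ↔ ((i : ℕ) + 1 = j ∨ (j : ℕ) + 1 = i))
    {s : ℕ → SignType}
    (hs : ∀ k : ℕ, (hk : k + 1 < n) →
      s k = P ⟨k, Nat.lt_of_succ_lt hk⟩ ⟨k + 1, hk⟩ * P ⟨k + 1, hk⟩ ⟨k, Nat.lt_of_succ_lt hk⟩)
    (huniq : RequiresUniqueInertia P) {act₁ act₂ : ℕ → Prop}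
    (h₁ : IsNearCovering n act₁) (h₂ : IsNearCovering n act₂)
    (hsub : ∀ k, 2 * k + 1 < n → ¬ MeetsSign s act₂ (-1) (2 * k + 1) →
      MeetsSign s act₁ 1 (2 * k + 1))
    {k : ℕ} (hk : 2 * k + 1 < n) (hpos : MeetsSign s act₁ 1 (2 * k + 1)) :
    ¬ MeetsSign s act₂ (-1) (2 * k + 1) := by
  intro hneg
  obtain ⟨B₁, hB₁, hle₁, -⟩ := exists_inertia_bounds htri hs h₁
  obtain ⟨B₂, hB₂, -, hle₂⟩ := exists_inertia_bounds htri hs h₂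
  have hlt := Set.ncard_lt_ncard (s := {v : {i : Fin n // Odd (i : ℕ)} |
      ¬ MeetsSign s act₂ (-1) (v : Fin n)})
    (t := {v : {i : Fin n // Odd (i : ℕ)} | MeetsSign s act₁ 1 (v : Fin n)}) ?_ (Set.toFinite _)
  · rw [huniq B₁ B₂ hB₁ hB₂] at hle₁
    omega
  · refine Set.ssubset_iff_subset_ne.mpr ⟨?_, fun heq => ?_⟩
    · rintro ⟨⟨v, hv⟩, m, hm⟩ h
      simp only at hm
      subst hm
      exact hsub m hv h
    · have h : (⟨⟨2 * k + 1, hk⟩, k, rfl⟩ : {i : Fin n // Odd (i : ℕ)}) ∈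
        {v : {i : Fin n // Odd (i : ℕ)} | MeetsSign s act₁ 1 (v : Fin n)} := hpos
      rw [← heq] at h
      exact h hneg

/-- The matching of the path on `n` vertices that uses the edges `2 * k` for `k < i` or `j < k`
and the edges `2 * k + 1` for `i ≤ k < j`. -/
def shiftedMatching (n i j k : ℕ) : Prop :=
  k + 1 < n ∧ (k % 2 = 0 ∧ (k < 2 * i ∨ 2 * j < k) ∨ k % 2 = 1 ∧ 2 * i < k ∧ k < 2 * j)

lemma isNearCovering_shiftedMatching {n i j : ℕ} (hij : i ≤ j) :
    IsNearCovering n (shiftedMatching n i j) where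
  lt _ h := h.1
  matching k h h' := by
    unfold shiftedMatching at h h'
    omega
  cover u v hu hv hun hvn h1 h2 h3 h4 := by
    unfold shiftedMatching at h1 h2 h3 h4
    rw [Nat.odd_iff] at hu hv
    omega

lemma meetsSign_shiftedMatching {n i j : ℕ} (hj : i < j → 2 * j < n) (hij : i ≤ j)
    (s : ℕ → SignType) (σ : SignType) {k : ℕ} (hk : 2 * k + 1 < n) :
    MeetsSign s (shiftedMatching n i j) σ (2 * k + 1) ↔
      (k < i ∨ j < k) ∧ s (2 * k) = σ ∨ (i ≤ k ∧ k < j) ∧ s (2 * k + 1) = σ := by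
  have h1 : shiftedMatching n i j (2 * k) ↔ k < i ∨ j < k := by
    unfold shiftedMatching
    omega
  have h2 : shiftedMatching n i j (2 * k + 1) ↔ i ≤ k ∧ k < j := by
    unfold shiftedMatching
    omega
  rw [MeetsSign, Nat.add_sub_cancel, h1, h2]

lemma eq_one_or_eq_neg_one {σ : SignType} (h : σ ≠ 0) : σ = 1 ∨ σ = -1 := by
  cases σ <;> simp_all

lemma edgeSign_pair_eq_of_odd {n : ℕ} (hn : Odd n) {P : Matrix (Fin n) (Fin n) SignType}
    (htri : ∀ i j : Fin n, P i j ≠ 0 ↔ ((i : ℕ) + 1 = j ∨ (j : ℕ) + 1 = i))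
    {s : ℕ → SignType}
    (hs : ∀ k : ℕ, (hk : k + 1 < n) →
      s k = P ⟨k, Nat.lt_of_succ_lt hk⟩ ⟨k + 1, hk⟩ * P ⟨k + 1, hk⟩ ⟨k, Nat.lt_of_succ_lt hk⟩)
    (huniq : RequiresUniqueInertia P) {i : ℕ} (hi : 2 * i + 2 < n) :
    s (2 * i) = s (2 * i + 1) := by
  obtain ⟨m, rfl⟩ := hn
  have hs0 : ∀ k, k + 1 < 2 * m + 1 → s k = 1 ∨ s k = -1 := fun k hk =>
    eq_one_or_eq_neg_one (edgeSign_ne_zero htri hs hk)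
  have h₁ := isNearCovering_shiftedMatching (n := 2 * m + 1) (i := i) (j := m) (by omega)
  have h₂ := isNearCovering_shiftedMatching (n := 2 * m + 1) (i := i + 1) (j := m)
    (by omega)
  have key₁ : ∀ σ k, 2 * k + 1 < 2 * m + 1 → _ := fun σ k hk =>
    meetsSign_shiftedMatching (i := i) (j := m) (by omega) (by omega) s σ hk
  have key₂ : ∀ σ k, 2 * k + 1 < 2 * m + 1 → _ := fun σ k hk =>
    meetsSign_shiftedMatching (i := i + 1) (j := m) (by omega) (by omega) s σ hk
  have hi' : 2 * i + 1 < 2 * m + 1 := by omega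
  rcases hs0 (2 * i) (by omega) with he | he <;> rcases hs0 (2 * i + 1) hi with ho | ho
  · rw [he, ho]
  · refine absurd ?_ (not_meetsSign_neg_one_of_requiresUniqueInertia htri hs huniq h₂ h₁ ?_ hi' ?_)
    · rw [key₁ _ _ hi']
      exact .inr ⟨by omega, ho⟩
    · intro k hk
      rw [key₁ _ _ hk, key₂ _ _ hk]
      have := hs0 (2 * k) (by omega)
      have := hs0 (2 * k + 1) (by omega)
      by_cases hki : k = i
      · subst hki; grind
      · grind
    · rw [key₂ _ _ hi']
      exact .inl ⟨by omega, he⟩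
  · refine absurd ?_ (not_meetsSign_neg_one_of_requiresUniqueInertia htri hs huniq h₁ h₂ ?_ hi' ?_)
    · rw [key₂ _ _ hi']
      exact .inl ⟨by omega, he⟩
    · intro k hk
      rw [key₁ _ _ hk, key₂ _ _ hk]
      have := hs0 (2 * k) (by omega)
      have := hs0 (2 * k + 1) (by omega)
      by_cases hki : k = i
      · subst hki; grind
      · grind
    · rw [key₁ _ _ hi']
      exact .inr ⟨by omega, ho⟩
  · rw [he, ho]

lemma false_of_inner_run_of_even {n : ℕ} (hn : Even n) {P : Matrix (Fin n) (Fin n) SignType}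
    (htri : ∀ i j : Fin n, P i j ≠ 0 ↔ ((i : ℕ) + 1 = j ∨ (j : ℕ) + 1 = i))
    {s : ℕ → SignType}
    (hs : ∀ k : ℕ, (hk : k + 1 < n) →
      s k = P ⟨k, Nat.lt_of_succ_lt hk⟩ ⟨k + 1, hk⟩ * P ⟨k + 1, hk⟩ ⟨k, Nat.lt_of_succ_lt hk⟩)
    (huniq : RequiresUniqueInertia P) {i j : ℕ} (hij : i < j) (hj : 2 * j + 1 < n)
    {σ : SignType} (hrun : ∀ k, 2 * i < k → k < 2 * j → s k = σ)
    (hi : s (2 * i) ≠ σ) (hj' : s (2 * j) ≠ σ) : False := by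
  obtain ⟨m, rfl⟩ := hn
  have hs0 : ∀ k, k + 1 < m + m → s k = 1 ∨ s k = -1 := fun k hk =>
    eq_one_or_eq_neg_one (edgeSign_ne_zero htri hs hk)
  have h₁ := isNearCovering_shiftedMatching (n := m + m) (i := m) (j := m) (by omega)
  have h₂ := isNearCovering_shiftedMatching (n := m + m) (i := i) (j := j) (by omega)
  have key₁ : ∀ σ k, 2 * k + 1 < m + m → _ := fun σ k hk =>
    meetsSign_shiftedMatching (i := m) (j := m) (by omega) (by omega) s σ hk
  have key₂ : ∀ σ k, 2 * k + 1 < m + m → _ := fun σ k hk =>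
    meetsSign_shiftedMatching (i := i) (j := j) (by omega) (by omega) s σ hk
  have hi' : 2 * i + 1 < m + m := by omega
  have hinner : s (2 * i + 1) = σ := hrun _ (by omega) (by omega)
  have hsi := hs0 (2 * i) (by omega)
  have hsj := hs0 (2 * j) (by omega)
  rcases hs0 (2 * i + 1) (by omega) with ho | ho <;> rw [ho] at hinner <;> subst hinner
  · have he : s (2 * i) = -1 := hsi.resolve_left hi
    have he' : s (2 * j) = -1 := hsj.resolve_left hj'
    refine absurd ?_ (not_meetsSign_neg_one_of_requiresUniqueInertia htri hs huniq h₂ h₁ ?_ hi' ?_)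
    · rw [key₁ _ _ hi']
      exact .inl ⟨by omega, he⟩
    · intro k hk
      rw [key₁ _ _ hk, key₂ _ _ hk]
      have := hs0 (2 * k) (by omega)
      have := hrun (2 * k + 1)
      by_cases hki : k = j
      · subst hki; grind
      · grind
    · rw [key₂ _ _ hi']
      exact .inr ⟨by omega, ho⟩
  · have he : s (2 * i) = 1 := hsi.resolve_right hi
    have he' : s (2 * j) = 1 := hsj.resolve_right hj'
    refine absurd ?_ (not_meetsSign_neg_one_of_requiresUniqueInertia htri hs huniq h₁ h₂ ?_ hi' ?_)
    · rw [key₂ _ _ hi']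
      exact .inr ⟨by omega, ho⟩
    · intro k hk
      rw [key₁ _ _ hk, key₂ _ _ hk]
      have := hs0 (2 * k) (by omega)
      have := hrun (2 * k + 1)
      by_cases hki : k = j
      · subst hki; grind
      · grind
    · rw [key₁ _ _ hi']
      exact .inl ⟨by omega, he⟩

/-- Between a sign change ending at an odd edge and one starting at an odd edge there is a constant
stretch bounded by two sign changes of the same kind. -/
lemma exists_inner_run {s : ℕ → SignType} (d : ℕ) : ∀ k, s (2 * k) ≠ s (2 * k + 1) →
    s (2 * (k + d) + 1) ≠ s (2 * (k + d) + 2) →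
    ∃ i j, k ≤ i ∧ i < j ∧ j ≤ k + d + 1 ∧ s (2 * i) ≠ s (2 * i + 1) ∧
      s (2 * j) ≠ s (2 * i + 1) ∧ ∀ l, 2 * i < l → l < 2 * j → s l = s (2 * i + 1) := by
  induction d using Nat.strong_induction_on with
  | _ d ih =>
    intro k hk hd
    by_cases hc : ∃ l, 2 * k + 1 ≤ l ∧ l < 2 * (k + d) + 1 ∧ s l ≠ s (l + 1)
    · obtain ⟨l, hl1, hl2, hl⟩ := hc
      rcases Nat.even_or_odd' l with ⟨m, rfl | rfl⟩
      · obtain ⟨i, j, h1, h2, h3, h⟩ := ih (k + d - m) (by omega) m hl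
          (by rwa [show m + (k + d - m) = k + d by omega])
        exact ⟨i, j, by omega, h2, by omega, h⟩
      · obtain ⟨i, j, h1, h2, h3, h⟩ := ih (m - k) (by omega) k hk
          (by rwa [show k + (m - k) = m by omega])
        exact ⟨i, j, h1, h2, by omega, h⟩
    · push Not at hc
      have hconst : ∀ t, t ≤ 2 * d → s (2 * k + 1 + t) = s (2 * k + 1) := by
        intro t
        induction t with
        | zero => simp
        | succ t iht =>
          exact fun ht => (hc (2 * k + 1 + t) (by omega) (by omega)).symm.trans (iht (by omega))
      refine ⟨k, k + d + 1, le_rfl, by omega, le_rfl, hk, fun h => hd ?_, fun l hl1 hl2 => ?_⟩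
      · have := hconst (2 * d) le_rfl
        rw [show 2 * k + 1 + 2 * d = 2 * (k + d) + 1 by ring] at this
        rw [this, ← h]
        ring_nf
      · have := hconst (l - (2 * k + 1)) (by omega)
        rwa [show 2 * k + 1 + (l - (2 * k + 1)) = l by omega] at this

/-- An irreducible tridiagonal sign pattern with `0`-diagonal that requires a unique inertia
has at most one maximal signed run of odd length. -/
theorem tridiagonal_unique_inertia_at_most_one_odd_run (n : ℕ) (hn : 2 ≤ n)
    (P : Matrix (Fin n) (Fin n) SignType)
    (htri : ∀ i j : Fin n, P i j ≠ 0 ↔ ((i : ℕ) + 1 = j ∨ (j : ℕ) + 1 = i))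
    (s : ℕ → SignType)
    (hs : ∀ k : ℕ, (hk : k + 1 < n) →
      s k = P ⟨k, Nat.lt_of_succ_lt hk⟩ ⟨k + 1, hk⟩ * P ⟨k + 1, hk⟩ ⟨k, Nat.lt_of_succ_lt hk⟩)
    (huniq : RequiresUniqueInertia P) :
    ∀ a b a' b', MaximalSignedRun n s a b → MaximalSignedRun n s a' b' →
      Odd (b - a + 1) → Odd (b' - a' + 1) → a = a' ∧ b = b' := by
  have hruns : ∀ {a b}, MaximalSignedRun n s a b → Odd (b - a + 1) →
      Even n ∧ a % 2 = 0 ∧ b % 2 = 0 := by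
    rintro a b ⟨hab, hb, hc, hl, hr⟩ hodd
    rw [Nat.odd_iff] at hodd
    rcases Nat.even_or_odd n with heven | hnodd
    · refine ⟨heven, ?_⟩
      have hn2 := Nat.even_iff.mp heven
      by_contra hpar
      obtain ⟨i, rfl⟩ : ∃ i, a = 2 * i + 1 := ⟨a / 2, by omega⟩
      obtain ⟨j, rfl⟩ : ∃ j, b = 2 * j + 1 := ⟨b / 2, by omega⟩
      refine false_of_inner_run_of_even heven htri hs huniq (i := i) (j := j + 1)
        (σ := s (2 * i + 1)) (by omega) (by omega) (fun k h1 h2 => hc k (by omega) (by omega))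
        (hl (by omega)) ?_
      rw [← hc (2 * j + 1) (by omega) le_rfl]
      exact hr (by omega)
    · exfalso
      have hpair := fun i => edgeSign_pair_eq_of_odd hnodd htri hs huniq (i := i)
      rw [Nat.odd_iff] at hnodd
      rcases Nat.even_or_odd' a with ⟨i, rfl | rfl⟩
      · obtain ⟨j, rfl⟩ : ∃ j, b = 2 * j := ⟨b / 2, by omega⟩
        exact hr (by omega) (hpair j (by omega)).symm
      · exact hl (by omega) (hpair i (by omega))
  have hlt : ∀ {a b a' b'}, MaximalSignedRun n s a b → MaximalSignedRun n s a' b' →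
      Odd (b - a + 1) → Odd (b' - a' + 1) → ¬ a < a' := by
    intro a b a' b' h h' hodd hodd' hlt
    obtain ⟨heven, ha, hb⟩ := hruns h hodd
    obtain ⟨-, ha', hb'⟩ := hruns h' hodd'
    obtain ⟨hab, hbn, hc, -, hr⟩ := h
    obtain ⟨hab', hbn', -, hl', -⟩ := h'
    have hba : b < a' := by
      by_contra hle
      exact hl' (by omega) ((hc _ (by omega) (by omega)).trans (hc _ (by omega) (by omega)).symm)
    obtain ⟨i, rfl⟩ : ∃ i, b = 2 * i := ⟨b / 2, by omega⟩
    obtain ⟨d, rfl⟩ : ∃ d, a' = 2 * (i + d) + 2 := ⟨(a' - 2 * i - 2) / 2, by omega⟩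
    obtain ⟨k, j, -, hkj, hj, h1, h2, h3⟩ := exists_inner_run d i (hr (by omega)).symm
      (hl' (by omega))
    exact false_of_inner_run_of_even heven htri hs huniq hkj (by omega) h3 h1 h2
  have hltb : ∀ {a b b'}, MaximalSignedRun n s a b → MaximalSignedRun n s a b' → ¬ b < b' := by
    rintro a b b' ⟨hab, -, hc, -, hr⟩ ⟨-, hbn', hc', -, -⟩ hlt
    exact hr (by omega) ((hc' _ (by omega) (by omega)).trans (hc _ hab le_rfl).symm)
  intro a b a' b' h h' hodd hodd'
  obtain rfl : a = a' :=
    le_antisymm (not_lt.mp (hlt h' h hodd' hodd)) (not_lt.mp (hlt h h' hodd hodd'))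
  exact ⟨rfl, le_antisymm (not_lt.mp (hltb h' h)) (not_lt.mp (hltb h h'))⟩
end

section
/- Let P be an irreducible tridiagonal sign pattern with 0-diagonal of order n ≥ 6, with edge signs s k = P k (k+1) · P (k+1) k for k = 0,…,n−2. Suppose there exists an index l with l + 4 ≤ n − 2 such that (s l, s (l+1), s (l+2), s (l+3), s (l+4)) = (+, −, −, −, +) or (−, +, +, +, −); this says exactly that the principal subpattern of P on the six consecutive indices l,…,l+5 is (up to equivalence) the 6×6 tridiagonal pattern P₆′ with consecutive edge signs +,−,−,−,+, or its negation P₆′₋ with consecutive edge signs −,+,+,+,−. Then P does not require a unique inertia: there exist B₁, B₂ ∈ Q(P) with In(B₁) ≠ In(B₂). -/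
open Polynomial Matrix

section Perturbation

open Filter Topology

theorem eventually_exists_root_of_simple_root (F Q : ℝ[X]) (u δ : ℝ) (hδ : 0 < δ)
    (hF : F.eval u ≠ 0) :
    ∀ᶠ c in 𝓝 (0 : ℝ), ∃ v, |v - u| < δ ∧ ((X - C u) * F - C c * Q).eval v = 0 := by
  have hcont : Continuous fun x => F.eval x * F.eval u := by fun_prop
  have hpos : ∀ᶠ x in 𝓝 u, 0 < F.eval x * F.eval u :=
    hcont.continuousAt.eventually (lt_mem_nhds (mul_self_pos.2 hF))
  obtain ⟨η, hη, hball⟩ := Metric.eventually_nhds_iff.1 hpos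
  set r := min η δ / 2 with hr
  have hr0 : 0 < r := by positivity
  have hrη : r < η := by
    have := min_le_left η δ
    linarith [lt_min hη hδ]
  have hrδ : r < δ := by
    have := min_le_right η δ
    linarith [lt_min hη hδ]
  have hright : 0 < F.eval (u + r) * F.eval u := hball (by simpa [abs_of_pos hr0] using hrη)
  have hleft : 0 < F.eval (u - r) * F.eval u := hball (by
    simpa [Real.dist_eq, abs_of_pos hr0] using hrη)
  let f : ℝ → ℝ → ℝ := fun c x => ((X - C u) * F - C c * Q).eval x * F.eval u
  have hf : ∀ x, Continuous fun c => f c x := fun x => by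
    simp only [f, eval_sub, eval_mul, eval_C, eval_X]
    fun_prop
  have h₁ : ∀ᶠ c in 𝓝 (0 : ℝ), 0 < f c (u + r) :=
    (hf _).continuousAt.eventually (lt_mem_nhds (by
      simp only [f, eval_sub, eval_mul, eval_C, eval_X]
      nlinarith))
  have h₂ : ∀ᶠ c in 𝓝 (0 : ℝ), f c (u - r) < 0 :=
    (hf _).continuousAt.eventually (gt_mem_nhds (by
      simp only [f, eval_sub, eval_mul, eval_C, eval_X]
      nlinarith))
  filter_upwards [h₁, h₂] with c hc₁ hc₂
  have hfc : Continuous (f c) := by fun_prop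
  obtain ⟨v, hv, hv0⟩ := intermediate_value_Icc (by linarith : u - r ≤ u + r)
    hfc.continuousOn ⟨hc₂.le, hc₁.le⟩
  refine ⟨v, ?_, ?_⟩
  · rw [abs_lt]
    constructor <;> linarith [hv.1, hv.2]
  · exact (mul_eq_zero.1 hv0).resolve_right hF

theorem eventually_eq_prod_perturbed_roots (U : Finset ℝ) (Q : ℝ[X]) (hQ : Q.degree < U.card) :
    ∀ᶠ c in 𝓝 (0 : ℝ), ∃ v : ℝ → ℝ, Set.InjOn v U ∧ (∀ u ∈ U, u < 0 → v u < 0) ∧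
      (∀ u ∈ U, 0 < u → 0 < v u) ∧
      ∏ u ∈ U, (X - C u) - C c * Q = ∏ u ∈ U, (X - C (v u)) := by
  obtain ⟨δ, hδ, hsep⟩ : ∃ δ : ℝ, 0 < δ ∧
      ∀ x ∈ insert 0 U, ∀ y ∈ insert 0 U, x ≠ y → 2 * δ ≤ |x - y| := by
    have : ∀ᶠ δ in 𝓝[>] (0 : ℝ),
        ∀ x ∈ insert 0 U, ∀ y ∈ insert 0 U, x ≠ y → 2 * δ ≤ |x - y| := by
      simp only [Finset.eventually_all]
      intro x _ y _
      by_cases hxy : x = y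
      · simp [hxy]
      · have h0 : 0 < |x - y| / 2 := by
          have := abs_pos.2 (sub_ne_zero.2 hxy)
          positivity
        filter_upwards [nhdsWithin_le_nhds (gt_mem_nhds h0)] with δ h _
        linarith
    obtain ⟨δ, h, h0⟩ := (this.and self_mem_nhdsWithin).exists
    exact ⟨δ, h0, h⟩
  have hroot : ∀ u ∈ U, ∀ᶠ c in 𝓝 (0 : ℝ), ∃ v, |v - u| < δ ∧
      (∏ u ∈ U, (X - C u) - C c * Q).eval v = 0 := by
    intro u hu
    rw [← Finset.mul_prod_erase U (fun u => X - C u) hu]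
    refine eventually_exists_root_of_simple_root _ Q u δ hδ ?_
    rw [eval_prod, Finset.prod_ne_zero_iff]
    intro w hw
    simpa [sub_eq_zero] using (Finset.ne_of_mem_erase hw).symm
  filter_upwards [(Finset.eventually_all U).2 hroot] with c hc
  choose! v hv hv0 using hc
  have hinj : Set.InjOn v U := by
    intro x hx y hy hxy
    by_contra hne
    have h := hsep x (Finset.mem_insert_of_mem hx) y (Finset.mem_insert_of_mem hy) hne
    have h₁ := abs_lt.1 (hv x hx)
    have h₂ := abs_lt.1 (hv y hy)
    rw [hxy] at h₁
    have : |x - y| < 2 * δ := abs_lt.2 ⟨by linarith, by linarith⟩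
    linarith
  refine ⟨v, hinj, ?_, ?_, ?_⟩
  · intro u hu hneg
    have h := hsep u (Finset.mem_insert_of_mem hu) 0 (Finset.mem_insert_self _ _) hneg.ne
    rw [sub_zero, abs_of_neg hneg] at h
    linarith [abs_lt.1 (hv u hu)]
  · intro u hu hpos
    have h := hsep u (Finset.mem_insert_of_mem hu) 0 (Finset.mem_insert_self _ _) hpos.ne'
    rw [sub_zero, abs_of_pos hpos] at h
    linarith [abs_lt.1 (hv u hu)]
  · have hmon : (∏ u ∈ U, (X - C u)).Monic := monic_prod_X_sub_C _ _
    have hdeg : (∏ u ∈ U, (X - C u)).degree = (U.card : WithBot ℕ) := by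
      rw [degree_prod]; simp
    have hlt : (C c * Q).degree < (∏ u ∈ U, (X - C u)).degree := by
      rw [hdeg]
      refine lt_of_le_of_lt ?_ hQ
      exact (degree_mul_le _ _).trans (by
        calc _ ≤ 0 + Q.degree := by gcongr; exact degree_C_le
          _ = _ := zero_add _)
    have hmon' := hmon.sub_of_left hlt
    have hdeg' : (∏ u ∈ U, (X - C u) - C c * Q).natDegree = U.card :=
      natDegree_eq_of_degree_eq_some ((degree_sub_eq_left_of_degree_lt hlt).trans hdeg)
    have hsub : (U.image v).val ≤ (∏ u ∈ U, (X - C u) - C c * Q).roots := by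
      rw [Multiset.le_iff_subset (Finset.nodup _)]
      intro x hx
      obtain ⟨u, hu, rfl⟩ := Finset.mem_image.1 hx
      exact (mem_roots hmon'.ne_zero).2 (hv0 u hu)
    have hcard : (U.image v).card = U.card := Finset.card_image_of_injOn hinj
    have heq : (U.image v).val = (∏ u ∈ U, (X - C u) - C c * Q).roots :=
      Multiset.eq_of_le_of_card_le hsub (by
        rw [← Finset.card_def, hcard, ← hdeg']
        exact card_roots' _)
    rw [← Finset.prod_image (g := v) (f := fun x => X - C x) hinj,
      ← prod_multiset_X_sub_C_of_monic_of_roots_card_eq hmon'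
      (by rw [← heq, ← Finset.card_def, hcard, hdeg']), ← heq]
    rfl

/-- `p` splits over `ℝ` with simple nonzero roots, exactly `k` of which are positive. -/
def HasSimpleRealRoots (p : ℝ[X]) (k : ℕ) : Prop :=
  ∃ U : Finset ℝ, 0 ∉ U ∧ p = ∏ u ∈ U, (X - C u) ∧ (U.filter (0 < ·)).card = k

theorem card_filter_pos_image {U : Finset ℝ} {v : ℝ → ℝ} (hinj : Set.InjOn v U)
    (h0 : 0 ∉ U) (hneg : ∀ u ∈ U, u < 0 → v u < 0) (hpos : ∀ u ∈ U, 0 < u → 0 < v u) :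
    ((U.image v).filter (0 < ·)).card = (U.filter (0 < ·)).card := by
  rw [Finset.filter_image, Finset.card_image_of_injOn (hinj.mono fun u hu => (Finset.mem_filter.1 hu).1)]
  congr 1
  refine Finset.filter_congr fun u hu => ⟨fun h => ?_, hpos u hu⟩
  rcases lt_trichotomy u 0 with hu0 | rfl | hu0
  · exact absurd h (hneg u hu hu0).not_gt
  · exact absurd hu h0
  · exact hu0

theorem HasSimpleRealRoots.eventually_sub {p q : ℝ[X]} {k : ℕ} (hp : HasSimpleRealRoots p k)
    (hq : q.degree < p.degree) :
    ∀ᶠ c in 𝓝 (0 : ℝ), HasSimpleRealRoots (p - C c * q) k := by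
  obtain ⟨U, h0, rfl, hk⟩ := hp
  rw [degree_prod] at hq
  filter_upwards [eventually_eq_prod_perturbed_roots U q (by simpa using hq)] with
    c ⟨v, hinj, hneg, hpos, h⟩
  refine ⟨U.image v, ?_, ?_, (card_filter_pos_image hinj h0 hneg hpos).trans hk⟩
  · intro hmem
    obtain ⟨u, hu, hu0⟩ := Finset.mem_image.1 hmem
    rcases lt_trichotomy u 0 with hlt | rfl | hlt
    · exact (hneg u hu hlt).ne hu0
    · exact h0 hu
    · exact (hpos u hu hlt).ne' hu0
  · rw [h, Finset.prod_image hinj]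

theorem HasSimpleRealRoots.eventually_X_mul_sub {p q : ℝ[X]} {k : ℕ}
    (hp : HasSimpleRealRoots p k) (hq : q.degree < (X * p).degree) (hq0 : q.eval 0 ≠ 0) :
    ∀ᶠ c in 𝓝 (0 : ℝ), c ≠ 0 →
      HasSimpleRealRoots (X * p - C c * q) k ∨ HasSimpleRealRoots (X * p - C c * q) (k + 1) := by
  obtain ⟨U, h0, rfl, hk⟩ := hp
  have hX : X * ∏ u ∈ U, (X - C u) = ∏ u ∈ insert (0 : ℝ) U, (X - C u) := by
    simp [Finset.prod_insert h0]
  rw [hX, degree_prod] at hq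
  rw [hX]
  filter_upwards [eventually_eq_prod_perturbed_roots (insert 0 U) q
    (by simpa using hq)] with c ⟨v, hinj, hneg, hpos, h⟩ hc
  have hinjU : Set.InjOn v U := hinj.mono (by simp)
  have hv0 : v 0 ≠ 0 := by
    intro hv0
    have := congrArg (eval 0) h
    simp [Finset.prod_insert h0, hv0, hc, hq0] at this
  have hnot : v 0 ∉ U.image v := by
    intro hmem
    obtain ⟨u, hu, hu0⟩ := Finset.mem_image.1 hmem
    exact h0 (hinj (Finset.mem_insert_of_mem hu) (Finset.mem_insert_self 0 U) hu0 ▸ hu)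
  have hcard := (card_filter_pos_image hinjU h0
    (fun u hu => hneg u (Finset.mem_insert_of_mem hu))
    (fun u hu => hpos u (Finset.mem_insert_of_mem hu))).trans hk
  have hmem : (0 : ℝ) ∉ (insert 0 U).image v := by
    intro hmem
    obtain ⟨u, hu, hu0⟩ := Finset.mem_image.1 hmem
    rcases lt_trichotomy u 0 with hlt | rfl | hlt
    · exact (hneg u hu hlt).ne hu0
    · exact hv0 hu0
    · exact (hpos u hu hlt).ne' hu0
  have hprod : ∏ u ∈ insert 0 U, (X - C u) - C c * q =
      ∏ u ∈ (insert 0 U).image v, (X - C u) := by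
    rw [h, Finset.prod_image hinj]
  by_cases hsgn : 0 < v 0
  · refine Or.inr ⟨_, hmem, hprod, ?_⟩
    rw [Finset.image_insert, Finset.filter_insert, if_pos hsgn,
      Finset.card_insert_of_notMem (fun h => hnot (Finset.mem_filter.1 h).1), hcard]
  · refine Or.inl ⟨_, hmem, hprod, ?_⟩
    rw [Finset.image_insert, Finset.filter_insert, if_neg hsgn, hcard]

theorem HasSimpleRealRoots.eval_zero {p : ℝ[X]} {k : ℕ} (hp : HasSimpleRealRoots p k) :
    0 < (-1) ^ k * p.eval 0 := by
  obtain ⟨U, h0, rfl, rfl⟩ := hp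
  rw [← Finset.prod_filter_mul_prod_filter_not U (0 < ·), eval_mul, ← mul_assoc, eval_prod,
    eval_prod, ← Finset.prod_const, ← Finset.prod_mul_distrib]
  refine mul_pos (Finset.prod_pos fun u hu => ?_) (Finset.prod_pos fun u hu => ?_)
  · simpa using (Finset.mem_filter.1 hu).2
  · obtain ⟨hu, hle⟩ := Finset.mem_filter.1 hu
    have : u ≠ 0 := fun h => h0 (h ▸ hu)
    simpa using lt_of_le_of_ne (not_lt.1 hle) this

theorem HasSimpleRealRoots.even_add {p q : ℝ[X]} {j k : ℕ} (hp : HasSimpleRealRoots p j)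
    (hq : HasSimpleRealRoots q k) (h : 0 < p.eval 0 * q.eval 0) : Even (j + k) := by
  by_contra hodd
  have := mul_pos (mul_pos hp.eval_zero hq.eval_zero) h
  have hpow : (-1 : ℝ) ^ j * (-1) ^ k = -1 := by
    rw [← pow_add, (Nat.not_even_iff_odd.1 hodd).neg_one_pow]
  nlinarith [sq_nonneg (p.eval 0 * q.eval 0)]

end Perturbation

/-- The characteristic polynomial of an `n × n` tridiagonal matrix with zero diagonal and edge
products `a 0, …, a (n - 2)` is `X ^ (n % 2)` times this polynomial evaluated at `X ^ 2`. -/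
noncomputable def evenPart : ℕ → (ℕ → ℝ) → ℝ[X]
  | 0, _ => 1
  | 1, _ => 1
  | n + 2, a => (if Even n then X else 1) * evenPart (n + 1) (fun i => a (i + 1)) -
      C (a 0) * evenPart n (fun i => a (i + 2))

theorem evenPart_succ_succ (n : ℕ) (a : ℕ → ℝ) : evenPart (n + 2) a =
    (if Even n then X else 1) * evenPart (n + 1) (fun i => a (i + 1)) -
      C (a 0) * evenPart n (fun i => a (i + 2)) := by
  rw [evenPart]

theorem evenPart_succ_succ_right (n : ℕ) (a : ℕ → ℝ) : evenPart (n + 2) a =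
    (if Even n then X else 1) * evenPart (n + 1) a - C (a n) * evenPart n a := by
  induction n using Nat.twoStepInduction generalizing a with
  | zero => simp [evenPart]
  | one => simp [evenPart]; ring
  | more n ih₁ ih₂ =>
    rw [evenPart_succ_succ (n + 2), ih₂ (fun i => a (i + 1)), ih₁ (fun i => a (i + 2)),
      evenPart_succ_succ (n + 1) a, evenPart_succ_succ n a]
    have h : Even (n + 2) ↔ Even n := by simp [Nat.even_add]
    simp only [h]
    ring

theorem evenPart_congr {n : ℕ} {a b : ℕ → ℝ} (h : ∀ i, i + 1 < n → a i = b i) :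
    evenPart n a = evenPart n b := by
  induction n using Nat.twoStepInduction generalizing a b with
  | zero => rfl
  | one => rfl
  | more n ih₁ ih₂ =>
    rw [evenPart_succ_succ, evenPart_succ_succ, h 0 (by omega),
      ih₁ (fun i hi => h (i + 2) (by omega)), ih₂ (fun i hi => h (i + 1) (by omega))]

theorem evenPart_monic_natDegree (n : ℕ) (a : ℕ → ℝ) :
    (evenPart n a).Monic ∧ (evenPart n a).natDegree = n / 2 := by
  induction n using Nat.twoStepInduction generalizing a with
  | zero => simp [evenPart]
  | one => simp [evenPart]
  | more n ih₁ ih₂ =>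
    obtain ⟨hm₁, hd₁⟩ := ih₁ (fun i => a (i + 2))
    obtain ⟨hm₂, hd₂⟩ := ih₂ (fun i => a (i + 1))
    have hm : ((if Even n then X else 1) * evenPart (n + 1) (fun i => a (i + 1))).Monic := by
      split_ifs
      · exact monic_X.mul hm₂
      · simpa using hm₂
    have hd : ((if Even n then X else 1) * evenPart (n + 1) (fun i => a (i + 1))).natDegree =
        (n + 2) / 2 := by
      split_ifs with h
      · rw [monic_X.natDegree_mul hm₂, hd₂, natDegree_X]
        obtain ⟨m, rfl⟩ := h
        omega
      · rw [one_mul, hd₂]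
        obtain ⟨m, rfl⟩ := Nat.not_even_iff_odd.1 h
        omega
    have hlt : (C (a 0) * evenPart n (fun i => a (i + 2))).degree <
        ((if Even n then X else 1) * evenPart (n + 1) (fun i => a (i + 1))).degree := by
      refine degree_lt_degree (lt_of_le_of_lt (natDegree_C_mul_le _ _) ?_)
      rw [hd₁, hd]
      omega
    rw [evenPart_succ_succ]
    exact ⟨hm.sub_of_left hlt,
      (natDegree_eq_of_degree_eq (degree_sub_eq_left_of_degree_lt hlt)).trans hd⟩

theorem degree_evenPart (n : ℕ) (a : ℕ → ℝ) :
    (evenPart n a).degree = ((n / 2 : ℕ) : WithBot ℕ) := by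
  obtain ⟨hm, hd⟩ := evenPart_monic_natDegree n a
  rw [degree_eq_natDegree hm.ne_zero, hd]

theorem eval_zero_evenPart_mul_pos {n : ℕ} (hn : Even n) {a b : ℕ → ℝ}
    (hab : ∀ i, 0 < a i * b i) : 0 < (evenPart n a).eval 0 * (evenPart n b).eval 0 := by
  induction n using Nat.twoStepInduction generalizing a b with
  | zero => simp [evenPart]
  | one => simp at hn
  | more n ih₁ _ =>
    have hn' : Even n := by simpa [Nat.even_add] using hn
    have := mul_pos (hab 0) (ih₁ hn' (fun i => hab (i + 2)))
    simp only [evenPart_succ_succ, if_pos hn', eval_sub, eval_mul, eval_X, eval_C]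
    linarith

/-- Some two weightings with edge signs `s` on a path with `n` vertices have simple spectra whose
numbers of positive squared eigenvalues differ by two. -/
def AdmitsRootGap (n : ℕ) (s : ℕ → SignType) : Prop :=
  ∃ (k : ℕ) (a b : ℕ → ℝ), (∀ i, SignType.sign (a i) = s i) ∧ (∀ i, SignType.sign (b i) = s i) ∧
    HasSimpleRealRoots (evenPart n a) k ∧ HasSimpleRealRoots (evenPart n b) (k + 2)

open Filter Topology in
theorem exists_sign_eq_of_eventually {p : ℝ → Prop} (h : ∀ᶠ c in 𝓝 (0 : ℝ), p c) (σ : SignType) :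
    ∃ c, SignType.sign c = σ ∧ p c := by
  have ht : Tendsto (fun ε : ℝ => ε * (σ : ℝ)) (𝓝[>] 0) (𝓝 0) := by
    have : Continuous fun ε : ℝ => ε * (σ : ℝ) := by fun_prop
    simpa using (this.tendsto 0).mono_left nhdsWithin_le_nhds
  obtain ⟨ε, hp, hε⟩ := ((ht.eventually h).and self_mem_nhdsWithin).exists
  refine ⟨_, ?_, hp⟩
  rw [sign_mul, sign_pos hε, one_mul]
  cases σ <;> simp

theorem exists_extension_weight (m k : ℕ) {a b x y : ℕ → ℝ}
    (ha : HasSimpleRealRoots (evenPart (m + 1) a) k)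
    (hb : HasSimpleRealRoots (evenPart (m + 1) b) (k + 2))
    (hxy : ∀ i, 0 < x i * y i) {σ : SignType} (hσ : σ ≠ 0) :
    ∃ c : ℝ, SignType.sign c = σ ∧ ∃ k',
      HasSimpleRealRoots
        ((if Even m then X else 1) * evenPart (m + 1) a - C c * evenPart m x) k' ∧
      HasSimpleRealRoots
        ((if Even m then X else 1) * evenPart (m + 1) b - C c * evenPart m y) (k' + 2) := by
  by_cases hm : Even m
  · simp only [if_pos hm]
    have hdeg : ∀ z w, (evenPart m z).degree < (X * evenPart (m + 1) w).degree := by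
      intro z w
      rw [degree_mul, degree_X, degree_evenPart, degree_evenPart]
      obtain ⟨r, rfl⟩ := hm
      norm_cast
      omega
    have h0 := eval_zero_evenPart_mul_pos hm hxy
    obtain ⟨c, hc, hca, hcb⟩ := exists_sign_eq_of_eventually
      ((ha.eventually_X_mul_sub (hdeg x a) (left_ne_zero_of_mul h0.ne')).and
        (hb.eventually_X_mul_sub (hdeg y b) (right_ne_zero_of_mul h0.ne'))) σ
    have hc0 : c ≠ 0 := by
      rintro rfl
      exact hσ (by simpa using hc.symm)
    have hparity : 0 < (X * evenPart (m + 1) a - C c * evenPart m x).eval 0 *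
        (X * evenPart (m + 1) b - C c * evenPart m y).eval 0 := by
      simp only [eval_sub, eval_mul, eval_X, eval_C]
      linarith [mul_pos (mul_self_pos.2 hc0) h0]
    refine ⟨c, hc, ?_⟩
    rcases hca hc0 with h₁ | h₁ <;> rcases hcb hc0 with h₂ | h₂
    · exact ⟨k, h₁, h₂⟩
    · have := h₁.even_add h₂ hparity
      grind
    · have := h₁.even_add h₂ hparity
      grind
    · exact ⟨k + 1, h₁, h₂⟩
  · simp only [if_neg hm, one_mul]
    have hdeg : ∀ z w, (evenPart m z).degree < (evenPart (m + 1) w).degree := by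
      intro z w
      rw [degree_evenPart, degree_evenPart]
      obtain ⟨r, rfl⟩ := Nat.not_even_iff_odd.1 hm
      norm_cast
      omega
    obtain ⟨c, hc, h₁, h₂⟩ := exists_sign_eq_of_eventually
      ((ha.eventually_sub (hdeg x a)).and (hb.eventually_sub (hdeg y b))) σ
    exact ⟨c, hc, k, h₁, h₂⟩

theorem mul_pos_of_sign_eq {s : ℕ → SignType} (hs : ∀ i, s i ≠ 0) {a b : ℕ → ℝ}
    (ha : ∀ i, SignType.sign (a i) = s i) (hb : ∀ i, SignType.sign (b i) = s i) (i : ℕ) :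
    0 < a i * b i := by
  rw [← sign_eq_one_iff, sign_mul, ha, hb]
  have := hs i
  generalize s i = σ at *
  cases σ <;> simp_all

theorem AdmitsRootGap.succ_right {n : ℕ} (hn : n ≠ 0) {s : ℕ → SignType} (hs : ∀ i, s i ≠ 0)
    (h : AdmitsRootGap n s) : AdmitsRootGap (n + 1) s := by
  obtain ⟨m, rfl⟩ := Nat.exists_eq_succ_of_ne_zero hn
  obtain ⟨k, a, b, ha, hb, hka, hkb⟩ := h
  obtain ⟨c, hc, k', h₁, h₂⟩ :=
    exists_extension_weight m k hka hkb (mul_pos_of_sign_eq hs ha hb) (hs m)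
  have hsign : ∀ w : ℕ → ℝ, (∀ i, SignType.sign (w i) = s i) →
      ∀ i, SignType.sign (Function.update w m c i) = s i := by
    intro w hw i
    rcases eq_or_ne i m with rfl | hi
    · simpa using hc
    · simpa [hi] using hw i
  have hpart : ∀ w : ℕ → ℝ, evenPart (m + 2) (Function.update w m c) =
      (if Even m then X else 1) * evenPart (m + 1) w - C c * evenPart m w := by
    intro w
    have hw : ∀ r ≤ m + 1, evenPart r (Function.update w m c) = evenPart r w := fun r hr =>
      evenPart_congr fun i hi => Function.update_of_ne (by omega) _ _
    rw [evenPart_succ_succ_right, hw _ le_rfl, hw _ (Nat.le_succ m), Function.update_self]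
  exact ⟨k', _, _, hsign a ha, hsign b hb, (hpart a).symm ▸ h₁, (hpart b).symm ▸ h₂⟩

theorem AdmitsRootGap.succ_left {n : ℕ} (hn : n ≠ 0) {s : ℕ → SignType} (hs : ∀ i, s i ≠ 0)
    (h : AdmitsRootGap n (fun i => s (i + 1))) : AdmitsRootGap (n + 1) s := by
  obtain ⟨m, rfl⟩ := Nat.exists_eq_succ_of_ne_zero hn
  obtain ⟨k, a, b, ha, hb, hka, hkb⟩ := h
  obtain ⟨c, hc, k', h₁, h₂⟩ := exists_extension_weight m k hka hkb
    (fun i => mul_pos_of_sign_eq (fun i => hs (i + 1)) ha hb (i + 1)) (hs 0)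
  have hsign : ∀ w : ℕ → ℝ, (∀ i, SignType.sign (w i) = s (i + 1)) →
      ∀ i, SignType.sign (Nat.casesOn (motive := fun _ => ℝ) i c w) = s i := by
    rintro w hw (_ | i)
    · exact hc
    · exact hw i
  exact ⟨k', fun i => Nat.casesOn i c a, fun i => Nat.casesOn i c b, hsign a ha, hsign b hb,
    (evenPart_succ_succ m _).symm ▸ h₁, (evenPart_succ_succ m _).symm ▸ h₂⟩

theorem AdmitsRootGap.add_right {n m : ℕ} (hn : n ≠ 0) {s : ℕ → SignType} (hs : ∀ i, s i ≠ 0)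
    (h : AdmitsRootGap n s) : AdmitsRootGap (n + m) s := by
  induction m with
  | zero => exact h
  | succ m ih => exact ih.succ_right (by simp [hn]) hs

theorem AdmitsRootGap.add_left {n l : ℕ} (hn : n ≠ 0) {s : ℕ → SignType} (hs : ∀ i, s i ≠ 0)
    (h : AdmitsRootGap n (fun i => s (i + l))) : AdmitsRootGap (n + l) s := by
  induction l generalizing s with
  | zero => exact h
  | succ l ih =>
    exact (ih (s := fun i => s (i + 1)) (fun i => hs (i + 1))
      (by simpa [add_assoc, add_comm, add_left_comm] using h)).succ_left (by simp [hn]) hs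

theorem evenPart_six (a : ℕ → ℝ) : evenPart 6 a =
    X ^ 3 - C (a 0 + a 1 + a 2 + a 3 + a 4) * X ^ 2 +
      C (a 0 * a 2 + a 0 * a 3 + a 0 * a 4 + a 1 * a 3 + a 1 * a 4 + a 2 * a 4) * X -
      C (a 0 * a 2 * a 4) := by
  have h : Even 4 := by decide
  have h' : ¬ Even 3 := by decide
  simp [evenPart, h, h']
  ring

theorem hasSimpleRealRoots_cubic {p : ℝ[X]} {x y z : ℝ} (hxy : x ≠ y) (hxz : x ≠ z)
    (hyz : y ≠ z) (hx : x ≠ 0) (hy : y ≠ 0) (hz : z ≠ 0)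
    (hp : p = (X - C x) * (X - C y) * (X - C z)) :
    HasSimpleRealRoots p
      ((if 0 < x then 1 else 0) + (if 0 < y then 1 else 0) + if 0 < z then 1 else 0) := by
  refine ⟨{x, y, z}, by simp [hx.symm, hy.symm, hz.symm], ?_, ?_⟩
  · rw [Finset.prod_insert (by simp [hxy, hxz]), Finset.prod_insert (by simp [hyz]),
      Finset.prod_singleton, hp, mul_assoc]
  · rw [Finset.card_filter, Finset.sum_insert (by simp [hxy, hxz]),
      Finset.sum_insert (by simp [hyz]), Finset.sum_singleton, add_assoc]

theorem exists_weight_six {s : ℕ → SignType} (w₀ w₁ w₂ w₃ w₄ x y z : ℝ)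
    (hs₀ : SignType.sign w₀ = s 0) (hs₁ : SignType.sign w₁ = s 1) (hs₂ : SignType.sign w₂ = s 2)
    (hs₃ : SignType.sign w₃ = s 3) (hs₄ : SignType.sign w₄ = s 4)
    (h₁ : w₀ + w₁ + w₂ + w₃ + w₄ = x + y + z)
    (h₂ : w₀ * w₂ + w₀ * w₃ + w₀ * w₄ + w₁ * w₃ + w₁ * w₄ + w₂ * w₄ = x * y + x * z + y * z)
    (h₃ : w₀ * w₂ * w₄ = x * y * z) :
    ∃ a : ℕ → ℝ, (∀ i, SignType.sign (a i) = s i) ∧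
      evenPart 6 a = (X - C x) * (X - C y) * (X - C z) := by
  let a : ℕ → ℝ
    | 0 => w₀
    | 1 => w₁
    | 2 => w₂
    | 3 => w₃
    | 4 => w₄
    | i => s i
  refine ⟨a, ?_, ?_⟩
  · rintro (_ | _ | _ | _ | _ | i) <;> try assumption
    change SignType.sign ((s (i + 5) : SignType) : ℝ) = _
    cases s (i + 5) <;> simp
  · rw [evenPart_six]
    change X ^ 3 - C (w₀ + w₁ + w₂ + w₃ + w₄) * X ^ 2 +
      C (w₀ * w₂ + w₀ * w₃ + w₀ * w₄ + w₁ * w₃ + w₁ * w₄ + w₂ * w₄) * X -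
      C (w₀ * w₂ * w₄) = _
    rw [h₁, h₂, h₃]
    simp only [C_add, C_mul]
    ring

theorem admitsRootGap_six {s : ℕ → SignType}
    (h : (s 0, s 1, s 2, s 3, s 4) =
        (SignType.pos, SignType.neg, SignType.neg, SignType.neg, SignType.pos) ∨
      (s 0, s 1, s 2, s 3, s 4) =
        (SignType.neg, SignType.pos, SignType.pos, SignType.pos, SignType.neg)) :
    AdmitsRootGap 6 s := by
  simp only [Prod.mk.injEq] at h
  rcases h with ⟨h0, h1, h2, h3, h4⟩ | ⟨h0, h1, h2, h3, h4⟩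
  · obtain ⟨a, ha, hpa⟩ := exists_weight_six (s := s) (1) (-14) (-66) (-60) (4) (-1) (-2) (-132)
      (by simp [h0]) (by simp [h1]) (by simp [h2]) (by simp [h3]) (by simp [h4])
      (by norm_num) (by norm_num) (by norm_num)
    obtain ⟨b, hb, hpb⟩ := exists_weight_six (s := s) (1) (-1) (-1) (-5) (6) (-3) 1 2
      (by simp [h0]) (by simp [h1]) (by simp [h2]) (by simp [h3]) (by simp [h4])
      (by norm_num) (by norm_num) (by norm_num)
    refine ⟨0, a, b, ha, hb, ?_, ?_⟩
    · convert hasSimpleRealRoots_cubic _ _ _ _ _ _ hpa using 1 <;> norm_num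
    · convert hasSimpleRealRoots_cubic _ _ _ _ _ _ hpb using 1 <;> norm_num
  · obtain ⟨a, ha, hpa⟩ := exists_weight_six (s := s) (-1) (1) (1) (5) (-6) 3 (-1) (-2)
      (by simp [h0]) (by simp [h1]) (by simp [h2]) (by simp [h3]) (by simp [h4])
      (by norm_num) (by norm_num) (by norm_num)
    obtain ⟨b, hb, hpb⟩ := exists_weight_six (s := s) (-1) (14) (66) (60) (-4) 1 2 132
      (by simp [h0]) (by simp [h1]) (by simp [h2]) (by simp [h3]) (by simp [h4])
      (by norm_num) (by norm_num) (by norm_num)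
    refine ⟨1, a, b, ha, hb, ?_, ?_⟩
    · convert hasSimpleRealRoots_cubic _ _ _ _ _ _ hpa using 1 <;> norm_num
    · convert hasSimpleRealRoots_cubic _ _ _ _ _ _ hpb using 1 <;> norm_num

theorem det_eq_sub_of_tridiagonal {R : Type*} [CommRing R] {n : ℕ}
    (M : Matrix (Fin (n + 2)) (Fin (n + 2)) R) (hrow : ∀ j : Fin n, M 0 j.succ.succ = 0)
    (hcol : ∀ i : Fin n, M i.succ.succ 0 = 0) :
    M.det = M 0 0 * (M.submatrix Fin.succ Fin.succ).det -
      M 0 1 * M 1 0 * (M.submatrix (fun i : Fin n => i.succ.succ) fun i => i.succ.succ).det := by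
  have hminor : (M.submatrix Fin.succ (Fin.succAbove 1)).det =
      M 1 0 * (M.submatrix (fun i : Fin n => i.succ.succ) fun i => i.succ.succ).det := by
    rw [det_succ_column_zero, Fin.sum_univ_succ, Finset.sum_eq_zero]
    · have hcomp : ∀ j : Fin n, (1 : Fin (n + 2)).succAbove j.succ = j.succ.succ := fun j => by
        rw [← Fin.succ_zero_eq_one, Fin.succ_succAbove_succ, Fin.succAbove_zero]
      simp [Function.comp_def, hcomp]
    · intro i _
      simp [hcol]
  rw [det_succ_row_zero, Fin.sum_univ_succ, Fin.sum_univ_succ, Finset.sum_eq_zero]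
  · simp [hminor, mul_assoc, sub_eq_add_neg]
  · intro j _
    simp [hrow]

theorem charpoly_eq_evenPart {n : ℕ} (B : Matrix (Fin n) (Fin n) ℝ)
    (hB : ∀ i j : Fin n, ¬((i : ℕ) + 1 = j ∨ (j : ℕ) + 1 = i) → B i j = 0) (a : ℕ → ℝ)
    (ha : ∀ k, (hk : k + 1 < n) → a k = B ⟨k, Nat.lt_of_succ_lt hk⟩ ⟨k + 1, hk⟩ *
      B ⟨k + 1, hk⟩ ⟨k, Nat.lt_of_succ_lt hk⟩) :
    B.charpoly = X ^ (n % 2) * (evenPart n a).comp (X ^ 2) := by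
  induction n using Nat.twoStepInduction generalizing a with
  | zero => simp [evenPart, charpoly]
  | one => simp [evenPart, charpoly, hB]
  | more n ih₁ ih₂ =>
    have h₁ := ih₁ (B.submatrix (fun i : Fin n => i.succ.succ) fun i => i.succ.succ)
      (fun i j h => hB _ _ (by simpa using h)) (fun i => a (i + 2))
      (fun k hk => ha (k + 2) (by omega))
    have h₂ := ih₂ (B.submatrix Fin.succ Fin.succ)
      (fun i j h => hB _ _ (by simpa using h)) (fun i => a (i + 1))
      (fun k hk => ha (k + 1) (by omega))
    have hsub₁ : (B.charmatrix.submatrix (fun i : Fin n => i.succ.succ) fun i => i.succ.succ) =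
        (B.submatrix (fun i : Fin n => i.succ.succ) fun i => i.succ.succ).charmatrix := by
      ext1 i j
      simp [charmatrix_apply, diagonal_apply]
    have hsub₂ : B.charmatrix.submatrix Fin.succ Fin.succ =
        (B.submatrix Fin.succ Fin.succ).charmatrix := by
      ext1 i j
      simp [charmatrix_apply, diagonal_apply]
    have h00 : B 0 0 = 0 := hB 0 0 (by simp)
    have ha0 : a 0 = B 0 1 * B 1 0 := ha 0 (by omega)
    rw [charpoly, det_eq_sub_of_tridiagonal, hsub₁, hsub₂, ← charpoly, ← charpoly, h₁, h₂,
      evenPart_succ_succ, charmatrix_apply_eq, charmatrix_apply_ne _ _ _ (by simp),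
      charmatrix_apply_ne _ _ _ (by simp), h00, ha0]
    · rcases Nat.even_or_odd n with h | h
      · have e₁ : n % 2 = 0 := Nat.even_iff.1 h
        have e₂ : (n + 1) % 2 = 1 := by omega
        simp only [e₁, e₂, Nat.add_mod_right, if_pos h, sub_comp, mul_comp, X_comp, C_comp, C_mul,
          C_0]
        ring
      · have e₁ : n % 2 = 1 := Nat.odd_iff.1 h
        have e₂ : (n + 1) % 2 = 0 := by omega
        simp only [e₁, e₂, Nat.add_mod_right, if_neg (Nat.not_even_iff_odd.2 h), sub_comp,
          mul_comp, one_comp, C_comp, C_mul, C_0]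
        ring
    · intro j
      rw [charmatrix_apply_ne _ _ _ (Fin.succ_ne_zero _).symm, hB 0 _ (by simp), C_0, neg_zero]
    · intro j
      rw [charmatrix_apply_ne _ _ _ (Fin.succ_ne_zero _), hB _ 0 (by simp), C_0, neg_zero]

theorem card_filter_roots_X_sq_sub_C (u : ℝ) :
    ((X ^ 2 - C (u : ℂ)).roots.filter (fun z : ℂ => 0 < z.re)).card = if 0 < u then 1 else 0 := by
  have hfac : ∀ w : ℂ, w ^ 2 = u → (X ^ 2 - C (u : ℂ)).roots = {w} + {-w} := by
    intro w hw
    have : X ^ 2 - C (u : ℂ) = (X - C w) * (X - C (-w)) := by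
      rw [← hw, C_pow, C_neg]
      ring
    rw [this, roots_mul (mul_ne_zero (X_sub_C_ne_zero _) (X_sub_C_ne_zero _)), roots_X_sub_C,
      roots_X_sub_C]
  split_ifs with hu
  · rw [hfac (√u : ℝ) (by rw [← Complex.ofReal_pow, Real.sq_sqrt hu.le])]
    have h := Real.sqrt_pos.2 hu
    simp [Multiset.filter_singleton, h, h.le]
  · rw [hfac ((√(-u) : ℝ) * Complex.I) (by
      rw [mul_pow, ← Complex.ofReal_pow, Real.sq_sqrt (by linarith)]
      simp)]
    simp [Multiset.filter_singleton]

theorem inertia_fst_eq {n e k : ℕ} {B : Matrix (Fin n) (Fin n) ℝ} {p : ℝ[X]}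
    (hB : B.charpoly = X ^ e * p.comp (X ^ 2)) (hp : HasSimpleRealRoots p k) :
    (inertia B).1 = k := by
  obtain ⟨U, -, rfl, rfl⟩ := hp
  have hmap : B.charpoly.map (algebraMap ℝ ℂ) = X ^ e * ∏ u ∈ U, (X ^ 2 - C (u : ℂ)) := by
    rw [hB]
    simp [prod_comp, Polynomial.map_prod]
  have hne : ∏ u ∈ U, (X ^ 2 - C (u : ℂ)) ≠ 0 :=
    Finset.prod_ne_zero_iff.2 fun u _ => X_pow_sub_C_ne_zero two_pos _
  have hX : ((e • ({0} : Multiset ℂ)).filter (fun z : ℂ => 0 < z.re)) = 0 := by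
    rw [Multiset.filter_nsmul, Multiset.filter_singleton]
    simp
  simp only [inertia, charRoots]
  rw [hmap, roots_mul (mul_ne_zero (pow_ne_zero _ X_ne_zero) hne), roots_X_pow,
    Multiset.filter_add, hX, zero_add, roots_prod _ _ hne, Multiset.filter_bind,
    Multiset.card_bind, Finset.card_filter]
  simp only [Function.comp_def, card_filter_roots_X_sq_sub_C]
  rfl

theorem exists_mem_qClass_charpoly_eq {n : ℕ} (P : Matrix (Fin n) (Fin n) SignType)
    (htri : ∀ i j : Fin n, P i j ≠ 0 ↔ ((i : ℕ) + 1 = j ∨ (j : ℕ) + 1 = i)) (a : ℕ → ℝ)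
    (ha : ∀ k : ℕ, (hk : k + 1 < n) → SignType.sign (a k) =
      P ⟨k, Nat.lt_of_succ_lt hk⟩ ⟨k + 1, hk⟩ * P ⟨k + 1, hk⟩ ⟨k, Nat.lt_of_succ_lt hk⟩) :
    ∃ B, QClass P B ∧ B.charpoly = X ^ (n % 2) * (evenPart n a).comp (X ^ 2) := by
  have hcoe : ∀ σ : SignType, SignType.sign (σ : ℝ) = σ := by
    intro σ
    cases σ <;> simp
  refine ⟨of fun i j => if (i : ℕ) + 1 = j then |a i| * (P i j : ℝ) else P i j, fun i j => ?_,
    charpoly_eq_evenPart _ (fun i j h => ?_) a fun k hk => ?_⟩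
  · simp only [of_apply]
    split_ifs with h
    · have hne : a i ≠ 0 := by
        rw [← sign_ne_zero, ha i (by omega)]
        exact mul_ne_zero ((htri _ _).2 (by simp)) ((htri _ _).2 (by simp))
      rw [sign_mul, sign_pos (abs_pos.2 hne), one_mul, hcoe]
    · exact hcoe _
  · have : P i j = 0 := by
      by_contra hP
      exact h ((htri i j).1 hP)
    simp [this]
  · have h := ha k hk
    simp only [of_apply, if_true]
    rw [if_neg (by omega), mul_assoc, ← SignType.coe_mul, ← h, mul_comm]
    exact (sign_mul_abs _).symm

/-- An irreducible tridiagonal sign pattern with `0`-diagonal containing `P₆′` (consecutive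
edge signs `+,−,−,−,+`) or its negation `P₆′₋` (edge signs `−,+,+,+,−`) as a principal subpattern
on six consecutive indices does not require a unique inertia. -/
theorem tridiagonal_P6_subpattern_not_unique_inertia (n : ℕ) (hn : 6 ≤ n)
    (P : Matrix (Fin n) (Fin n) SignType)
    (htri : ∀ i j : Fin n, P i j ≠ 0 ↔ ((i : ℕ) + 1 = j ∨ (j : ℕ) + 1 = i))
    (s : ℕ → SignType)
    (hs : ∀ k : ℕ, (hk : k + 1 < n) →
      s k = P ⟨k, Nat.lt_of_succ_lt hk⟩ ⟨k + 1, hk⟩ * P ⟨k + 1, hk⟩ ⟨k, Nat.lt_of_succ_lt hk⟩)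
    (hsub : ∃ l : ℕ, l + 4 ≤ n - 2 ∧
      ((s l, s (l + 1), s (l + 2), s (l + 3), s (l + 4)) = (SignType.pos, SignType.neg, SignType.neg, SignType.neg, SignType.pos) ∨
        (s l, s (l + 1), s (l + 2), s (l + 3), s (l + 4)) = (SignType.neg, SignType.pos, SignType.pos, SignType.pos, SignType.neg))) :
    ∃ B₁ B₂, QClass P B₁ ∧ QClass P B₂ ∧ inertia B₁ ≠ inertia B₂ := by
  obtain ⟨l, hl, hsub⟩ := hsub
  let t : ℕ → SignType := fun i => if i + 1 < n then s i else 1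
  have ht : ∀ i, i + 1 < n → t i = s i := fun i hi => if_pos hi
  have ht0 : ∀ i, t i ≠ 0 := by
    intro i
    by_cases hi : i + 1 < n
    · rw [ht i hi, hs i hi]
      exact mul_ne_zero ((htri _ _).2 (by simp)) ((htri _ _).2 (by simp))
    · simp [t, hi]
  have hsix : AdmitsRootGap 6 fun i => t (i + l) := by
    refine admitsRootGap_six ?_
    rw [ht _ (by omega), ht _ (by omega), ht _ (by omega), ht _ (by omega), ht _ (by omega)]
    simpa only [add_comm _ l, add_zero] using hsub
  have hgap : AdmitsRootGap (6 + l + (n - 6 - l)) t :=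
    (hsix.add_left (by norm_num) ht0).add_right (by omega) ht0
  rw [show 6 + l + (n - 6 - l) = n by omega] at hgap
  obtain ⟨k, a, b, ha, hb, hka, hkb⟩ := hgap
  obtain ⟨B₁, hB₁, hp₁⟩ := exists_mem_qClass_charpoly_eq P htri a
    fun i hi => by rw [ha, ht i hi, hs i hi]
  obtain ⟨B₂, hB₂, hp₂⟩ := exists_mem_qClass_charpoly_eq P htri b
    fun i hi => by rw [hb, ht i hi, hs i hi]
  refine ⟨B₁, B₂, hB₁, hB₂, fun h => ?_⟩
  have h₁ := inertia_fst_eq hp₁ hka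
  have h₂ := inertia_fst_eq hp₂ hkb
  rw [h] at h₁
  omega
end
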